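/- Suppose each F_i is continuous and satisfies the Lipschitz condition |F_i(t,X) − F_i(t,Y)| ≤ L‖X − Y‖ for all t ∈ [0,T], X, Y ∈ (ℝ^m)^n. Then for each k > ‖F‖_∞/ε the penalized system ẋ_i^k(t) = F_i(t, X^k(t)) − k(d∇d)(x_i^k(t)), x_i^k(0) = x_i°, has a unique classical solution X^k on [0,T], and X^k converges uniformly on [0,T], as k → ∞, to the unique mild solution X of the confined particle system with initial condition X°. -/

import Mathlib

open Set MeasureTheory Filter
open scoped RealInnerProductSpace Topology NNReal ContDiff

noncomputable section

/-- Points of `ℝ^m`. -/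
abbrev Pt (m : ℕ) := EuclideanSpace ℝ (Fin m)

/-- Configurations of `n` particles in `ℝ^m`, equipped with the sup-norm
`‖X‖ = max_i |x_i|`. -/
abbrev Conf (m n : ℕ) := Fin n → Pt m

variable {m n : ℕ}

open Classical in
/-- Signed distance function with respect to the boundary of `Ω`:
nonpositive on `cl Ω`, positive outside. -/
def sgnDist (Ω : Set (Pt m)) (x : Pt m) : ℝ :=
  if x ∈ closure Ω then -Metric.infDist x (frontier Ω) else Metric.infDist x (frontier Ω)

/-- `Ω ⊆ ℝ^m` is a nonempty bounded open domain with `C²` boundary and outward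
unit normal field `ν`: the signed distance function is `C²` near each boundary
point, and its gradient on the boundary is the outward unit normal `ν`. -/
structure IsC2Domain (Ω : Set (Pt m)) (ν : Pt m → Pt m) : Prop where
  isOpen : IsOpen Ω
  nonempty : Ω.Nonempty
  bounded : Bornology.IsBounded Ω
  smoothBoundary : ∀ x ∈ frontier Ω, ContDiffAt ℝ 2 (sgnDist Ω) x
  grad_eq_normal : ∀ x ∈ frontier Ω, gradient (sgnDist Ω) x = ν x
  normal_unit : ∀ x ∈ frontier Ω, ‖ν x‖ = 1

open Classical in
/-- The one-sided projection `P(x,f)`: if `x ∈ ∂Ω` and `f · ν(x) > 0` then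
`P(x,f) = f - (f·ν(x)) ν(x)`, otherwise `P(x,f) = f`. -/
def oneProj (Ω : Set (Pt m)) (ν : Pt m → Pt m) (x f : Pt m) : Pt m :=
  if x ∈ frontier Ω ∧ 0 < ⟪f, ν x⟫ then f - ⟪f, ν x⟫ • ν x else f

/-- The set `G = (cl Ω)^n` of admissible configurations. -/
def Gset (Ω : Set (Pt m)) (n : ℕ) : Set (Conf m n) := {X | ∀ i, X i ∈ closure Ω}

/-- Mild solution of the confined particle system
`ẋ_i = H_i(t, X) = P(x_i, F_i(t,X))` on `[0,T]` with initial condition `X0`: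
each `x_i` is continuous, stays in `cl Ω` and satisfies
`x_i(t) = x_i(0) + ∫₀ᵗ H_i(s, X(s)) ds`. -/
def IsMildSol (Ω : Set (Pt m)) (ν : Pt m → Pt m) (F : Fin n → ℝ → Conf m n → Pt m)
    (T : ℝ) (X0 : Conf m n) (X : ℝ → Conf m n) : Prop :=
  (∀ i, ContinuousOn (fun t => X t i) (Icc 0 T)) ∧
  (∀ t ∈ Icc (0:ℝ) T, ∀ i, X t i ∈ closure Ω) ∧
  (∀ t ∈ Icc (0:ℝ) T, ∀ i,
    X t i = X0 i + ∫ s in (0:ℝ)..t, oneProj Ω ν (X s i) (F i s (X s)))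

/-- The distance function `d(x) = dist(x, cl Ω)`. -/
def distCl (Ω : Set (Pt m)) (x : Pt m) : ℝ := Metric.infDist x (closure Ω)

open Classical in
/-- The function `d ∇d`, extended by `0` on `cl Ω`. -/
def dGradd (Ω : Set (Pt m)) (x : Pt m) : Pt m :=
  if x ∈ closure Ω then 0 else distCl Ω x • gradient (distCl Ω) x

/-- Classical solution of the penalized system
`ẋ_i(t) = F_i(t, X(t)) - k (d∇d)(x_i(t))` on `[0,T]`. -/
def IsPenalSol (Ω : Set (Pt m)) (F : Fin n → ℝ → Conf m n → Pt m)
    (T k : ℝ) (X0 : Conf m n) (X : ℝ → Conf m n) : Prop :=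
  X 0 = X0 ∧
  ∀ i, ∀ t ∈ Icc (0:ℝ) T,
    HasDerivWithinAt (fun s => X s i) (F i t (X t) - k • dGradd Ω (X t i)) (Icc 0 T) t

/-- Admissible configurations with pairwise distinct particle positions. -/
def Gstar (Ω : Set (Pt m)) (n : ℕ) : Set (Conf m n) :=
  {X | (∀ i, X i ∈ closure Ω) ∧ ∀ i j, i ≠ j → X i ≠ X j}

/-- The particle interaction energy
`E(X) = (1/(n(n-1))) Σ_{j<i} V(x_i - x_j) + (1/n) Σ_i W(x_i)`. -/
def energy (V W : Pt m → ℝ) (X : Conf m n) : ℝ :=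
  (1 / ((n : ℝ) * ((n : ℝ) - 1))) *
      ∑ i : Fin n, ∑ j ∈ Finset.filter (fun j => j < i) Finset.univ, V (X i - X j) +
    (1 / (n : ℝ)) * ∑ i : Fin n, W (X i)

/-- The gradient `∇_{x_i} E(X)` of the energy with respect to particle `i`. -/
def Egrad (V W : Pt m → ℝ) (i : Fin n) (X : Conf m n) : Pt m :=
  gradient (fun y => energy V W (Function.update X i y)) (X i)

section geometry

variable {Ω : Set (Pt m)} {ν : Pt m → Pt m}

lemma exists_nearest (hne : Ω.Nonempty) (x : Pt m) :
    ∃ p ∈ closure Ω, distCl Ω x = ‖x - p‖ := by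
  obtain ⟨p, hp, h⟩ := isClosed_closure.exists_infDist_eq_dist hne.closure x
  exact ⟨p, hp, by rw [distCl, h, dist_eq_norm]⟩

lemma distCl_nonneg (x : Pt m) : 0 ≤ distCl Ω x := Metric.infDist_nonneg

lemma distCl_le {p : Pt m} (hp : p ∈ closure Ω) (x : Pt m) : distCl Ω x ≤ ‖x - p‖ := by
  rw [← dist_eq_norm]; exact Metric.infDist_le_dist_of_mem hp

lemma distCl_lip : LipschitzWith 1 (distCl Ω) := Metric.lipschitz_infDist_pt _

lemma distCl_le_add (x y : Pt m) : distCl Ω x ≤ distCl Ω y + ‖x - y‖ := by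
  rw [← dist_eq_norm]; exact Metric.infDist_le_infDist_add_dist

lemma distCl_eq_zero {x : Pt m} (hx : x ∈ closure Ω) : distCl Ω x = 0 :=
  Metric.infDist_zero_of_mem hx

lemma distCl_pos (hne : Ω.Nonempty) {x : Pt m} (hx : x ∉ closure Ω) : 0 < distCl Ω x :=
  (isClosed_closure.notMem_iff_infDist_pos hne.closure).1 hx

lemma mem_closure_of_distCl (hne : Ω.Nonempty) {x : Pt m} (hx : distCl Ω x = 0) :
    x ∈ closure Ω := by
  by_contra h
  exact (distCl_pos hne h).ne' hx

lemma distCl_ray {x p : Pt m} (hp : p ∈ closure Ω) (hd : distCl Ω x = ‖x - p‖) {s : ℝ}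
    (hs : s ∈ Icc (0:ℝ) 1) : distCl Ω (p + s • (x - p)) = s * distCl Ω x := by
  apply le_antisymm
  · refine (distCl_le hp _).trans ?_
    rw [add_sub_cancel_left, norm_smul, Real.norm_of_nonneg hs.1, hd]
  · have h := distCl_le_add (Ω := Ω) x (p + s • (x - p))
    have : x - (p + s • (x - p)) = (1 - s) • (x - p) := by module
    rw [this, norm_smul, Real.norm_of_nonneg (by linarith [hs.2]), ← hd] at h
    linarith

lemma nearest_mem_frontier (hO : IsOpen Ω) {x p : Pt m} (hp : p ∈ closure Ω)
    (hd : distCl Ω x = ‖x - p‖) (hpos : 0 < distCl Ω x) : p ∈ frontier Ω := by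
  rw [hO.frontier_eq]
  refine ⟨hp, fun hpo => ?_⟩
  have h1 : Tendsto (fun s : ℝ => p + s • (x - p)) (𝓝[>] 0) (𝓝 p) := by
    have : Continuous (fun s : ℝ => p + s • (x - p)) := by fun_prop
    have := this.tendsto 0
    simp only [zero_smul, add_zero] at this
    exact this.mono_left nhdsWithin_le_nhds
  have h2 := h1.eventually (hO.mem_nhds hpo)
  have h3 : ∀ᶠ s : ℝ in 𝓝[>] 0, s ∈ Ioc (0:ℝ) 1 := Ioc_mem_nhdsGT one_pos
  obtain ⟨s, hs, hs'⟩ := (h2.and h3).exists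
  have h4 := distCl_ray hp hd ⟨hs'.1.le, hs'.2⟩
  rw [distCl_eq_zero (subset_closure hs)] at h4
  have := mul_pos hs'.1 hpos
  linarith

lemma sgnDist_frontier {p : Pt m} (hp : p ∈ frontier Ω) : sgnDist Ω p = 0 := by
  simp [sgnDist, Metric.infDist_zero_of_mem hp]

lemma sgnDist_nonpos {q : Pt m} (hq : q ∈ closure Ω) : sgnDist Ω q ≤ 0 := by
  simp [sgnDist, hq, Metric.infDist_nonneg]

lemma mem_closure_of_sgnDist_neg {q : Pt m} (hq : sgnDist Ω q < 0) : q ∈ closure Ω := by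
  by_contra h
  simp only [sgnDist, h, if_false] at hq
  exact absurd hq (not_lt.2 Metric.infDist_nonneg)

lemma sgnDist_eq_distCl (hO : IsOpen Ω) (hne : Ω.Nonempty) {x : Pt m} (hx : x ∉ closure Ω) :
    sgnDist Ω x = distCl Ω x := by
  obtain ⟨p, hp, hd⟩ := exists_nearest hne x
  have hf := nearest_mem_frontier hO hp hd (distCl_pos hne hx)
  simp only [sgnDist, hx, if_false]
  apply le_antisymm
  · rw [hd, ← dist_eq_norm]; exact Metric.infDist_le_dist_of_mem hf
  · exact Metric.infDist_le_infDist_of_subset frontier_subset_closure ⟨p, hf⟩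

lemma sgnDist_ray (hO : IsOpen Ω) (hne : Ω.Nonempty) {x p : Pt m} (hp : p ∈ closure Ω)
    (hd : distCl Ω x = ‖x - p‖) (hpos : 0 < distCl Ω x) {s : ℝ}
    (hs : s ∈ Icc (0:ℝ) 1) : sgnDist Ω (p + s • (x - p)) = s * distCl Ω x := by
  have hr := distCl_ray hp hd hs
  rcases hs.1.eq_or_lt with rfl | h
  · simp [sgnDist_frontier (nearest_mem_frontier hO hp hd hpos)]
  · rw [sgnDist_eq_distCl hO hne, hr]
    intro hc
    rw [distCl_eq_zero hc] at hr
    have := mul_pos h hpos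
    linarith

lemma nearest_eq_normal (hΩ : IsC2Domain Ω ν) {x p : Pt m} (hp : p ∈ closure Ω)
    (hd : distCl Ω x = ‖x - p‖) (hpos : 0 < distCl Ω x) : x - p = distCl Ω x • ν p := by
  have hf := nearest_mem_frontier hΩ.isOpen hp hd hpos
  have hdiff : DifferentiableAt ℝ (sgnDist Ω) p :=
    (hΩ.smoothBoundary p hf).differentiableAt (by norm_num)
  have hg := hdiff.hasGradientAt.hasFDerivAt
  rw [hΩ.grad_eq_normal p hf] at hg
  have hl : HasDerivAt (fun s : ℝ => p + s • (x - p)) (x - p) 0 := by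
    simpa using ((hasDerivAt_id (0:ℝ)).smul_const (x - p)).const_add p
  have hg' : HasFDerivAt (sgnDist Ω) ((InnerProductSpace.toDual ℝ (Pt m)) (ν p))
      (p + (0:ℝ) • (x - p)) := by simpa using hg
  have h1 := (hg'.comp_hasDerivAt (0:ℝ) hl).hasDerivWithinAt (s := Icc 0 1)
  have h2 : HasDerivWithinAt (fun s : ℝ => s * distCl Ω x) (distCl Ω x) (Icc 0 1) 0 := by
    simpa using ((hasDerivAt_id (0:ℝ)).mul_const (distCl Ω x)).hasDerivWithinAt
  have h3 := h2.congr (f₁ := sgnDist Ω ∘ fun s : ℝ => p + s • (x - p))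
    (fun s hs => sgnDist_ray hΩ.isOpen hΩ.nonempty hp hd hpos hs)
    (sgnDist_ray hΩ.isOpen hΩ.nonempty hp hd hpos (by simp))
  have h4 := (uniqueDiffOn_Icc (zero_lt_one' ℝ) 0 (by simp)).eq_deriv _ h1 h3
  rw [InnerProductSpace.toDual_apply_apply] at h4
  rw [← sub_eq_zero, ← norm_eq_zero, ← sq_eq_zero_iff, norm_sub_sq_real, norm_smul,
    hΩ.normal_unit p hf, real_inner_smul_right, real_inner_comm, h4, ← hd,
    Real.norm_of_nonneg hpos.le]
  ring

lemma dGradd_eq {x p : Pt m} (hp : p ∈ closure Ω)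
    (hd : distCl Ω x = ‖x - p‖) (hpos : 0 < distCl Ω x)
    (hdiff : DifferentiableAt ℝ (distCl Ω) x) : dGradd Ω x = x - p := by
  have hx : x ∉ closure Ω := fun h => hpos.ne' (distCl_eq_zero h)
  have hn : ‖gradient (distCl Ω) x‖ ≤ 1 := by
    rw [gradient, LinearIsometryEquiv.norm_map]
    simpa using norm_fderiv_le_of_lipschitz ℝ (distCl_lip (Ω := Ω)) (x₀ := x)
  have hg := hdiff.hasGradientAt.hasFDerivAt
  have hl : HasDerivAt (fun s : ℝ => p + s • (x - p)) (x - p) 1 := by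
    simpa using ((hasDerivAt_id (1:ℝ)).smul_const (x - p)).const_add p
  have hg' : HasFDerivAt (distCl Ω) ((InnerProductSpace.toDual ℝ (Pt m)) (gradient (distCl Ω) x))
      (p + (1:ℝ) • (x - p)) := by simpa using hg
  have h1 := (hg'.comp_hasDerivAt (1:ℝ) hl).hasDerivWithinAt (s := Icc 0 1)
  have h2 : HasDerivWithinAt (fun s : ℝ => s * distCl Ω x) (distCl Ω x) (Icc 0 1) 1 := by
    simpa using ((hasDerivAt_id (1:ℝ)).mul_const (distCl Ω x)).hasDerivWithinAt
  have h3 := h2.congr (f₁ := distCl Ω ∘ fun s : ℝ => p + s • (x - p))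
    (fun s hs => distCl_ray hp hd hs)
    (distCl_ray hp hd (by simp))
  have h4 := (uniqueDiffOn_Icc (zero_lt_one' ℝ) 1 (by simp)).eq_deriv _ h1 h3
  rw [InnerProductSpace.toDual_apply_apply] at h4
  simp only [dGradd, hx, if_false]
  have h5 : ‖distCl Ω x • gradient (distCl Ω) x - (x - p)‖ ^ 2 ≤ 0 := by
    rw [norm_sub_sq_real, norm_smul, real_inner_smul_left, h4, ← hd,
      Real.norm_of_nonneg hpos.le]
    nlinarith [norm_nonneg (gradient (distCl Ω) x), mul_pos hpos hpos, mul_nonneg (sub_nonneg.2 hn) (norm_nonneg (gradient (distCl Ω) x)), mul_nonneg (mul_pos hpos hpos).le (mul_nonneg (sub_nonneg.2 hn) (norm_nonneg (gradient (distCl Ω) x))), mul_nonneg (mul_pos hpos hpos).le (sub_nonneg.2 hn)]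
  rw [← sub_eq_zero, ← norm_eq_zero]
  exact pow_eq_zero_iff (two_ne_zero) |>.1 (le_antisymm h5 (sq_nonneg _))

lemma mem_thick {ε : ℝ} (hε : 0 < ε) (hne : Ω.Nonempty) {x : Pt m} (hx : distCl Ω x ≤ ε) :
    x ∈ closure (Metric.thickening ε Ω) := by
  rw [closure_thickening hε, ← Metric.cthickening_closure]
  obtain ⟨p, hp, hd⟩ := exists_nearest hne x
  exact Metric.mem_cthickening_of_dist_le x p ε _ hp (by rw [dist_eq_norm, ← hd]; exact hx)

/-- Local gradient regularity. -/
lemma gradient_contDiffAt {f : Pt m → ℝ} {x : Pt m} (h : ContDiffAt ℝ 2 f x) :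
    ContDiffAt ℝ 1 (gradient f) x := by
  have h1 : ContDiffAt ℝ 1 (fderiv ℝ f) x := h.fderiv_right (by norm_num)
  exact (InnerProductSpace.toDual ℝ (Pt m)).symm.toContinuousLinearEquiv.contDiff.contDiffAt.comp
    x h1

lemma exists_local_const (hΩ : IsC2Domain Ω ν) {p₀ : Pt m} (hp₀ : p₀ ∈ frontier Ω) :
    ∃ t ∈ 𝓝 p₀, ∃ C : ℝ, 0 ≤ C ∧ ∀ p ∈ t ∩ frontier Ω, ∀ q ∈ closure Ω,
      ⟪ν p, q - p⟫ ≤ C * ‖q - p‖ ^ 2 := by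
  have hc := hΩ.smoothBoundary p₀ hp₀
  obtain ⟨K, s, hs, hK⟩ := (hc.fderiv_right (m := 1) (by norm_num)).exists_lipschitzOnWith
  have hev : ∀ᶠ y in 𝓝 p₀, ContDiffAt ℝ 2 (sgnDist Ω) y := hc.eventually (by simp)
  obtain ⟨r, hr, hrs⟩ := Metric.eventually_nhds_iff_ball.1
    ((show ∀ᶠ y in 𝓝 p₀, y ∈ s from hs).and hev)
  refine ⟨Metric.ball p₀ (r/2), Metric.ball_mem_nhds _ (by positivity), K + 2 / r,
    by positivity, ?_⟩
  rintro p ⟨hp, hpf⟩ q hq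
  have hν := hΩ.normal_unit p hpf
  by_cases hqp : ‖q - p‖ < r / 2
  · have hball : ∀ y ∈ Metric.ball p (r/2), y ∈ s ∧ ContDiffAt ℝ 2 (sgnDist Ω) y :=
      fun y hy => hrs y (Metric.ball_subset_ball' (by
        have := Metric.mem_ball.1 hp; linarith) hy)
    have hseg : segment ℝ p q ⊆ Metric.ball p (r/2) :=
      (convex_ball p (r/2)).segment_subset (Metric.mem_ball_self (by positivity))
        (by rwa [Metric.mem_ball, dist_eq_norm])
    have hmv := (convex_segment p q).norm_image_sub_le_of_norm_hasFDerivWithin_le'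
      (f := sgnDist Ω) (f' := fderiv ℝ (sgnDist Ω)) (φ := fderiv ℝ (sgnDist Ω) p)
      (C := K * ‖q - p‖) (x := p) (y := q)
      (fun y hy => (((hball _ (hseg hy)).2.differentiableAt
        (by norm_num)).hasFDerivAt).hasFDerivWithinAt)
      (fun y hy => by
        have h1 := hK.norm_sub_le (hball _ (hseg hy)).1 (hball _ (hseg (left_mem_segment ℝ p q))).1
        refine h1.trans ?_
        gcongr
        exact norm_sub_le_of_mem_segment hy)
      (left_mem_segment ℝ p q) (right_mem_segment ℝ p q)
    have hfd : fderiv ℝ (sgnDist Ω) p (q - p) = ⟪ν p, q - p⟫ := by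
      rw [← hΩ.grad_eq_normal p hpf, gradient, ← InnerProductSpace.toDual_apply_apply,
        LinearIsometryEquiv.apply_symm_apply]
    rw [hfd, sgnDist_frontier hpf, Real.norm_eq_abs] at hmv
    have h2 := (abs_le.1 hmv).1
    have h3 := sgnDist_nonpos hq
    have h4 : 0 ≤ 2 / r * ‖q - p‖ ^ 2 := by positivity
    nlinarith
  · push Not at hqp
    have h1 := real_inner_le_norm (ν p) (q - p)
    rw [hν, one_mul] at h1
    have h2 : ‖q - p‖ ≤ 2 / r * ‖q - p‖ ^ 2 := by
      have : 1 ≤ 2 / r * ‖q - p‖ := by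
        rw [div_mul_eq_mul_div, le_div_iff₀ hr]; linarith
      nlinarith [norm_nonneg (q - p)]
    have h4 : 0 ≤ K * ‖q - p‖ ^ 2 := by positivity
    linarith

lemma frontier_compact (hΩ : IsC2Domain Ω ν) : IsCompact (frontier Ω) :=
  Metric.isCompact_of_isClosed_isBounded isClosed_frontier
    (hΩ.bounded.closure.subset frontier_subset_closure)

lemma exists_prox_const (hΩ : IsC2Domain Ω ν) :
    ∃ C : ℝ, 0 ≤ C ∧ ∀ p ∈ frontier Ω, ∀ q ∈ closure Ω, ⟪ν p, q - p⟫ ≤ C * ‖q - p‖ ^ 2 := by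
  have := (frontier_compact hΩ).induction_on
    (p := fun s => ∃ C : ℝ, 0 ≤ C ∧ ∀ p ∈ s ∩ frontier Ω, ∀ q ∈ closure Ω,
      ⟪ν p, q - p⟫ ≤ C * ‖q - p‖ ^ 2) ⟨0, le_rfl, by simp⟩
    (fun s t hst ⟨C, hC, h⟩ => ⟨C, hC, fun p hp => h p ⟨hst hp.1, hp.2⟩⟩)
    (fun s t ⟨C, hC, h⟩ ⟨C', hC', h'⟩ => ⟨C + C', by positivity, fun p hp q hq => by
      have a1 : 0 ≤ C * ‖q - p‖ ^ 2 := by positivity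
      have a2 : 0 ≤ C' * ‖q - p‖ ^ 2 := by positivity
      rcases hp.1 with h1 | h1
      · have := h p ⟨h1, hp.2⟩ q hq; linarith
      · have := h' p ⟨h1, hp.2⟩ q hq; linarith⟩)
    (fun x hx => by
      obtain ⟨t, ht, h⟩ := exists_local_const hΩ hx
      exact ⟨t, mem_nhdsWithin_of_mem_nhds ht, h⟩)
  obtain ⟨C, hC, h⟩ := this
  exact ⟨C, hC, fun p hp => h p ⟨hp, hp⟩⟩

lemma geo (hΩ : IsC2Domain Ω ν) {ε : ℝ} (hε : 0 < ε)
    (hd2 : ∀ x ∈ closure (Metric.thickening ε Ω) \ closure Ω, ContDiffAt ℝ 2 (distCl Ω) x)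
    {C : ℝ} (hC : ∀ p ∈ frontier Ω, ∀ q ∈ closure Ω, ⟪ν p, q - p⟫ ≤ C * ‖q - p‖ ^ 2)
    {x : Pt m} (hx : distCl Ω x ≤ ε) :
    ∃ p ∈ closure Ω, dGradd Ω x = x - p ∧ distCl Ω x = ‖x - p‖ ∧
      ∀ q ∈ closure Ω, ⟪x - p, q - p⟫ ≤ distCl Ω x * (C * ‖q - p‖ ^ 2) := by
  by_cases hxc : x ∈ closure Ω
  · refine ⟨x, hxc, by simp [dGradd, hxc], by simp [distCl_eq_zero hxc], fun q hq => ?_⟩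
    simp [distCl_eq_zero hxc]
  · obtain ⟨p, hp, hd⟩ := exists_nearest hΩ.nonempty x
    have hpos := distCl_pos hΩ.nonempty hxc
    refine ⟨p, hp, dGradd_eq hp hd hpos
      ((hd2 x ⟨mem_thick hε hΩ.nonempty hx, hxc⟩).differentiableAt (by norm_num)), hd,
      fun q hq => ?_⟩
    rw [nearest_eq_normal hΩ hp hd hpos, real_inner_smul_left]
    exact mul_le_mul_of_nonneg_left
      (hC p (nearest_mem_frontier hΩ.isOpen hp hd hpos) q hq) hpos.le

lemma smul_locLip {f : Pt m → ℝ} {g : Pt m → Pt m} {s : Set (Pt m)} {x : Pt m}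
    {K K' : ℝ≥0} (hf : LipschitzOnWith K f s) (hg : LipschitzOnWith K' g s) (hs : s ∈ 𝓝 x) :
    ∃ C : ℝ≥0, ∃ t ∈ 𝓝 x, LipschitzOnWith C (fun y => f y • g y) t := by
  have hfc := (hf.continuousOn.continuousAt hs).norm.eventually
    (gt_mem_nhds (lt_add_one ‖f x‖))
  have hgc := (hg.continuousOn.continuousAt hs).norm.eventually
    (gt_mem_nhds (lt_add_one ‖g x‖))
  refine ⟨(‖f x‖₊ + 1) * K' + K * (‖g x‖₊ + 1), _, (hfc.and (hgc.and hs)), ?_⟩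
  apply LipschitzOnWith.of_dist_le_mul
  rintro y ⟨hy1, hy2, hy3⟩ z ⟨hz1, hz2, hz3⟩
  rw [dist_eq_norm, dist_eq_norm]
  have e : f y • g y - f z • g z = f y • (g y - g z) + (f y - f z) • g z := by module
  rw [e]
  refine (norm_add_le _ _).trans ?_
  rw [norm_smul, norm_smul]
  have h1 := hf.norm_sub_le hy3 hz3
  have h2 := hg.norm_sub_le hy3 hz3
  push_cast
  have : ‖f y‖ * ‖g y - g z‖ ≤ (‖f x‖ + 1) * (K' * ‖y - z‖) := by gcongr
  have : ‖f y - f z‖ * ‖g z‖ ≤ (K * ‖y - z‖) * (‖g x‖ + 1) := by gcongr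
  linarith

lemma dGradd_lip (hΩ : IsC2Domain Ω ν) {ε : ℝ} (hε : 0 < ε)
    (hd2 : ∀ x ∈ closure (Metric.thickening ε Ω) \ closure Ω, ContDiffAt ℝ 2 (distCl Ω) x) :
    ∃ K : ℝ≥0, LipschitzOnWith K (dGradd Ω) {x | distCl Ω x ≤ ε} := by
  have hcomp : IsCompact {x | distCl Ω x ≤ ε} := by
    refine Metric.isCompact_of_isClosed_isBounded
      (isClosed_le distCl_lip.continuous continuous_const) ?_
    refine (hΩ.bounded.cthickening (δ := ε)).subset fun x hx => ?_
    rw [← closure_thickening hε]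
    exact mem_thick hε hΩ.nonempty hx
  apply LocallyLipschitzOn.exists_lipschitzOnWith_of_compact hcomp
  intro x hx
  suffices h : ∃ C : ℝ≥0, ∃ t ∈ 𝓝 x, LipschitzOnWith C (dGradd Ω) t by
    obtain ⟨C, t, ht, h⟩ := h
    exact ⟨C, t, mem_nhdsWithin_of_mem_nhds ht, h⟩
  by_cases hxc : x ∈ closure Ω
  · by_cases hxo : x ∈ Ω
    · refine ⟨0, Ω, hΩ.isOpen.mem_nhds hxo, ?_⟩
      apply LipschitzOnWith.of_dist_le_mul
      intro y hy z hz
      simp [dGradd, subset_closure hy, subset_closure hz]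
    · have hxf : x ∈ frontier Ω := by rw [hΩ.isOpen.frontier_eq]; exact ⟨hxc, hxo⟩
      have hc := hΩ.smoothBoundary x hxf
      obtain ⟨K, s, hs, hK⟩ := (hc.of_le (m := 1) (by norm_num)).exists_lipschitzOnWith
      obtain ⟨K', s', hs', hK'⟩ := (gradient_contDiffAt hc).exists_lipschitzOnWith
      have hKm : LipschitzOnWith K (fun y => max (sgnDist Ω y) 0) s := by
        apply LipschitzOnWith.of_dist_le_mul
        intro y hy z hz
        refine le_trans ?_ (hK.dist_le_mul y hy z hz)
        rw [Real.dist_eq, Real.dist_eq]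
        exact abs_max_sub_max_le_abs _ _ _
      obtain ⟨C, t, ht, h⟩ := smul_locLip (hKm.mono (s := s ∩ s') inter_subset_left)
        (hK'.mono inter_subset_right) (Filter.inter_mem hs hs')
      refine ⟨C, t, ht, ?_⟩
      convert h using 1
      ext1 y
      by_cases hy : y ∈ closure Ω
      · simp [dGradd, hy, sgnDist_nonpos hy]
      · have he : sgnDist Ω =ᶠ[𝓝 y] distCl Ω := by
          filter_upwards [isClosed_closure.isOpen_compl.mem_nhds hy] with z hz
          exact sgnDist_eq_distCl hΩ.isOpen hΩ.nonempty hz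
        have hgr : gradient (sgnDist Ω) y = gradient (distCl Ω) y := by
          rw [gradient, gradient, he.fderiv_eq]
        simp only [dGradd, hy, if_false, hgr, he.self_of_nhds]
        rw [max_eq_left (distCl_nonneg y)]
  · have hc := hd2 x ⟨mem_thick hε hΩ.nonempty hx, hxc⟩
    obtain ⟨K', s', hs', hK'⟩ := (gradient_contDiffAt hc).exists_lipschitzOnWith
    obtain ⟨C, t, ht, h⟩ := smul_locLip ((distCl_lip (Ω := Ω)).lipschitzOnWith (s := s'))
        hK' hs'
    refine ⟨C, t ∩ (closure Ω)ᶜ, Filter.inter_mem ht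
      (isClosed_closure.isOpen_compl.mem_nhds hxc), ?_⟩
    apply LipschitzOnWith.of_dist_le_mul
    intro y hy z hz
    have h1 : y ∉ closure Ω := hy.2
    have h2 : z ∉ closure Ω := hz.2
    simpa [dGradd, h1, h2] using h.dist_le_mul y hy.1 z hz.1

lemma inward_mem (hΩ : IsC2Domain Ω ν) {p v : Pt m} (hp : p ∈ frontier Ω)
    (hv : ⟪ν p, v⟫ < 0) : ∀ᶠ h : ℝ in 𝓝[>] 0, p + h • v ∈ closure Ω := by
  have hdiff : DifferentiableAt ℝ (sgnDist Ω) p :=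
    (hΩ.smoothBoundary p hp).differentiableAt (by norm_num)
  have hg := hdiff.hasGradientAt.hasFDerivAt
  rw [hΩ.grad_eq_normal p hp] at hg
  have hl : HasDerivAt (fun s : ℝ => p + s • v) v 0 := by
    simpa using ((hasDerivAt_id (0:ℝ)).smul_const v).const_add p
  have hg' : HasFDerivAt (sgnDist Ω) ((InnerProductSpace.toDual ℝ (Pt m)) (ν p))
      (p + (0:ℝ) • v) := by simpa using hg
  have h1 := (hg'.comp_hasDerivAt (0:ℝ) hl)
  rw [InnerProductSpace.toDual_apply_apply] at h1
  have h2 := (hasDerivAt_iff_tendsto_slope_left_right.1 h1).2.eventually (gt_mem_nhds hv)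
  filter_upwards [h2, self_mem_nhdsWithin] with s hs hs0
  have hs0' : (0:ℝ) < s := hs0
  apply mem_closure_of_sgnDist_neg
  simp only [slope_def_field, Function.comp_apply, zero_smul, add_zero, sub_zero,
    sgnDist_frontier hp] at hs
  rw [div_lt_iff₀ hs0'] at hs
  simpa using hs

lemma tangent_zero (hΩ : IsC2Domain Ω ν) {x : ℝ → Pt m} {v : Pt m} {t : ℝ}
    (hx : HasDerivAt x v t) (hxt : x t ∈ frontier Ω) (hm : ∀ᶠ s in 𝓝 t, x s ∈ closure Ω) :
    ⟪ν (x t), v⟫ = 0 := by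
  have hdiff : DifferentiableAt ℝ (sgnDist Ω) (x t) :=
    (hΩ.smoothBoundary _ hxt).differentiableAt (by norm_num)
  have hg := hdiff.hasGradientAt.hasFDerivAt
  rw [hΩ.grad_eq_normal _ hxt] at hg
  have h1 := (hg.comp_hasDerivAt t hx)
  rw [InnerProductSpace.toDual_apply_apply] at h1
  refine IsLocalMax.hasDerivAt_eq_zero ?_ h1
  filter_upwards [hm] with s hs
  simpa [sgnDist_frontier hxt] using sgnDist_nonpos hs

end geometry

section analysis

variable {Ω : Set (Pt m)} {ν : Pt m → Pt m}

lemma ae_mvt {f g : ℝ → ℝ} {a b : ℝ} (hab : a ≤ b)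
    (hf : AbsolutelyContinuousOnInterval f a b) (hg : IntervalIntegrable g volume a b)
    (h : ∀ᵐ t, t ∈ Ioo a b → ∃ v, HasDerivAt f v t ∧ v ≤ g t) :
    f b - f a ≤ ∫ t in a..b, g t := by
  rw [← hf.integral_deriv_eq_sub]
  refine intervalIntegral.integral_mono_ae_restrict hab hf.intervalIntegrable_deriv hg ?_
  rw [← Measure.restrict_congr_set Ioo_ae_eq_Icc]
  rw [EventuallyLE, ae_restrict_iff' measurableSet_Ioo]
  filter_upwards [h] with t ht htI
  obtain ⟨v, hv, hvg⟩ := ht htI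
  rw [hv.deriv]; exact hvg

lemma int_gronwall {S : ℝ → ℝ} {T A B : ℝ} (hT : 0 ≤ T) (hA : 0 ≤ A) (hB : 0 ≤ B)
    (hS : ContinuousOn S (Icc 0 T))
    (h : ∀ t ∈ Icc (0:ℝ) T, S t ≤ ∫ s in (0:ℝ)..t, (A * S s + B)) :
    ∀ t ∈ Icc (0:ℝ) T, S t ≤ gronwallBound 0 A B T := by
  set R : ℝ → ℝ := IccExtend hT ((Icc 0 T).domRestrict S) with hR
  have hRc : Continuous R := (continuousOn_iff_continuous_domRestrict.1 hS).Icc_extend'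
  have hRe : ∀ t ∈ Icc (0:ℝ) T, R t = S t := fun t ht => by
    rw [hR, IccExtend_of_mem _ _ ht, domRestrict_apply]
  set U : ℝ → ℝ := fun t => ∫ s in (0:ℝ)..t, (A * R s + B) with hU
  have hUd : ∀ t, HasDerivAt U (A * R t + B) t := fun t => by
    have hc : Continuous (fun s => A * R s + B) := by fun_prop
    exact intervalIntegral.integral_hasDerivAt_right (hc.intervalIntegrable _ _)
      (hc.stronglyMeasurableAtFilter _ _) hc.continuousAt
  have hle : ∀ t ∈ Icc (0:ℝ) T, S t ≤ U t := fun t ht => by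
    refine (h t ht).trans (le_of_eq ?_)
    apply intervalIntegral.integral_congr
    intro s hs
    rw [uIcc_of_le ht.1] at hs
    simp only [hRe s ⟨hs.1, hs.2.trans ht.2⟩]
  have hg := le_gronwallBound_of_liminf_deriv_right_le (f := U) (f' := fun t => A * R t + B)
    (δ := 0) (K := A) (ε := B) (a := 0) (b := T)
    (fun t _ => (hUd t).continuousAt.continuousWithinAt)
    (fun t _ r hr => by
      have := ((hUd t).hasDerivWithinAt (s := Ici t)).liminf_right_slope_le hr
      simpa [slope_def_field, div_eq_inv_mul] using this)
    (by simp [hU])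
    (fun t ht => by
      have h1 := hle t ⟨ht.1, ht.2.le⟩
      rw [← hRe t ⟨ht.1, ht.2.le⟩] at h1
      gcongr)
  intro t ht
  refine (hle t ht).trans ((hg t ht).trans ?_)
  exact gronwallBound_mono le_rfl hB hA (by linarith [ht.2])

/-- Approximate solutions: the reaction `w` is almost a proximal normal. -/
structure IsApprox (Ω : Set (Pt m)) (F : Fin n → ℝ → Conf m n → Pt m)
    (T M D : ℝ) (X0 : Conf m n) (η : ℝ) (X : ℝ → Conf m n) : Prop where
  init : X 0 = X0
  lip : ∀ i, ∀ s ∈ Icc (0:ℝ) T, ∀ t ∈ Icc (0:ℝ) T, ‖X s i - X t i‖ ≤ 2 * M * |s - t|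
  near : ∀ i, ∀ t ∈ Icc (0:ℝ) T, distCl Ω (X t i) ≤ η
  ode : ∀ i, ∀ᵐ t : ℝ, t ∈ Ioo 0 T → ∃ w p, HasDerivAt (fun s => X s i) (F i t (X t) - w) t ∧
    ‖w‖ ≤ M ∧ p ∈ closure Ω ∧ ‖X t i - p‖ ≤ η ∧ ∀ q ∈ closure Ω, ⟪w, q - p⟫ ≤ D * ‖q - p‖ ^ 2

lemma lipOn_of {x : ℝ → Pt m} {M T : ℝ} (hM0 : 0 ≤ M)
    (h : ∀ s ∈ Icc (0:ℝ) T, ∀ t ∈ Icc (0:ℝ) T, ‖x s - x t‖ ≤ 2 * M * |s - t|) :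
    LipschitzOnWith (2 * M).toNNReal x (Icc 0 T) := by
  apply LipschitzOnWith.of_dist_le_mul
  intro s hs t ht
  rw [dist_eq_norm, Real.dist_eq, Real.coe_toNNReal _ (by positivity)]
  exact h s hs t ht

lemma ac_norm_sq {x : ℝ → Pt m} {K : ℝ≥0} {a b : ℝ} (hab : a ≤ b)
    (h : LipschitzOnWith K x (Icc a b)) :
    AbsolutelyContinuousOnInterval (fun s => ‖x s‖ ^ 2) a b := by
  have h1 : LipschitzOnWith K (fun s => ‖x s‖) (uIcc a b) := by
    rw [uIcc_of_le hab]
    simpa [Function.comp_def] using (lipschitzWith_one_norm (E := Pt m)).comp_lipschitzOnWith h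
  have h2 := h1.absolutelyContinuousOnInterval
  have := h2.mul h2
  simpa [sq, Pi.mul_def] using this

lemma approx_stability {F : Fin n → ℝ → Conf m n → Pt m} {T M D L : ℝ} (hT : 0 ≤ T)
    (hM0 : 0 ≤ M) (hD : 0 ≤ D) (hL : 0 ≤ L)
    (hLip : ∀ i, ∀ t ∈ Icc (0:ℝ) T, ∀ X Y : Conf m n,
      ‖F i t X - F i t Y‖ ≤ L * ‖X - Y‖)
    {X0 : Conf m n} {η η' : ℝ} (hη : 0 ≤ η) (hη' : 0 ≤ η') {X Y : ℝ → Conf m n}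
    (hX : IsApprox Ω F T M D X0 η X) (hY : IsApprox Ω F T M D X0 η' Y) :
    ∀ t ∈ Icc (0:ℝ) T, ‖X t - Y t‖ ^ 2 ≤
      gronwallBound 0 (n * (2 * L + 8 * D))
        (n * (8 * D * (η + η') ^ 2 + 4 * M * (η + η'))) T := by
  set e := η + η' with he
  have he0 : 0 ≤ e := by positivity
  set E := 8 * D * e ^ 2 + 4 * M * e with hE
  have hE0 : 0 ≤ E := by positivity
  set S : ℝ → ℝ := fun t => ∑ i, ‖X t i - Y t i‖ ^ 2 with hS
  have hxl := fun i => lipOn_of hM0 (hX.lip i)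
  have hyl := fun i => lipOn_of hM0 (hY.lip i)
  have hSc : ContinuousOn S (Icc 0 T) := by
    refine continuousOn_finsetSum _ fun i _ => ?_
    exact (((hxl i).continuousOn.sub (hyl i).continuousOn).norm).pow 2
  have hS_ge : ∀ t i, ‖X t i - Y t i‖ ^ 2 ≤ S t := fun t i =>
    Finset.single_le_sum (f := fun i => ‖X t i - Y t i‖ ^ 2) (fun j _ => sq_nonneg _)
      (Finset.mem_univ i)
  have hSn : ∀ t, 0 ≤ S t := fun t => Finset.sum_nonneg fun j _ => sq_nonneg _
  have hnorm : ∀ t, ‖X t - Y t‖ ≤ √(S t) := fun t => by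
    rw [pi_norm_le_iff_of_nonneg (Real.sqrt_nonneg _)]
    exact fun i => Real.le_sqrt_of_sq_le (hS_ge t i)
  have hnsq : ∀ t, ‖X t - Y t‖ ^ 2 ≤ S t := fun t => by
    calc _ ≤ √(S t) ^ 2 := by gcongr; exact hnorm t
      _ = S t := Real.sq_sqrt (hSn t)
  have key : ∀ i, ∀ t ∈ Icc (0:ℝ) T, ‖X t i - Y t i‖ ^ 2 ≤
      ∫ s in (0:ℝ)..t, ((2 * L + 8 * D) * S s + E) := by
    intro i t ht
    have hsub : Icc 0 t ⊆ Icc 0 T := Icc_subset_Icc le_rfl ht.2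
    have hl : LipschitzOnWith ((2 * M).toNNReal + (2 * M).toNNReal)
        (fun s => X s i - Y s i) (Icc 0 t) := ((hxl i).sub (hyl i)).mono hsub
    have := ae_mvt ht.1 (ac_norm_sq ht.1 hl)
      (g := fun s => (2 * L + 8 * D) * S s + E)
      (ContinuousOn.intervalIntegrable (by
        rw [uIcc_of_le ht.1]
        exact (continuousOn_const.mul (hSc.mono hsub)).add continuousOn_const)) ?_
    · simpa [hX.init, hY.init] using this
    · filter_upwards [hX.ode i, hY.ode i] with s h1 h2 hs
      have hsT : s ∈ Ioo 0 T := ⟨hs.1, hs.2.trans_le ht.2⟩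
      obtain ⟨w, p, hw, hwM, hp, hpη, hq⟩ := h1 hsT
      obtain ⟨w', p', hw', hwM', hp', hpη', hq'⟩ := h2 hsT
      refine ⟨_, (hw.sub hw').norm_sq, ?_⟩
      simp only [Pi.sub_apply]
      set x := X s i
      set y := Y s i
      have hF := hLip i s (Ioo_subset_Icc_self hsT) (X s) (Y s)
      have a1 : ⟪x - y, F i s (X s) - F i s (Y s)⟫ ≤ L * S s := by
        refine (real_inner_le_norm _ _).trans ?_
        have b1 : ‖x - y‖ ≤ √(S s) := Real.le_sqrt_of_sq_le (hS_ge s i)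
        calc ‖x - y‖ * ‖F i s (X s) - F i s (Y s)‖ ≤ √(S s) * (L * √(S s)) := by
              gcongr; exact hF.trans (by gcongr; exact hnorm s)
          _ = L * (√(S s) * √(S s)) := by ring
          _ = L * S s := by rw [Real.mul_self_sqrt (hSn s)]
      have hpp : ‖p' - p‖ ^ 2 ≤ 2 * S s + 2 * e ^ 2 := by
        have b1 : ‖p' - p‖ ≤ ‖x - y‖ + e := by
          have : p' - p = -(x - y) + ((x - p) - (y - p')) := by module
          rw [this]
          refine (norm_add_le _ _).trans ?_
          rw [norm_neg]
          have := norm_sub_le (x - p) (y - p')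
          linarith
        have b2 := hS_ge s i
        nlinarith [norm_nonneg (p' - p), norm_nonneg (x - y), sq_nonneg (‖x - y‖ - e)]
      have hdev : ‖(y - p') - (x - p)‖ ≤ e := by
        have := norm_sub_le (y - p') (x - p); linarith
      have a2 : ⟪w, y - x⟫ ≤ D * (2 * S s + 2 * e ^ 2) + M * e := by
        have : y - x = (p' - p) + ((y - p') - (x - p)) := by module
        rw [this, inner_add_right]
        have c1 := (hq p' hp').trans (mul_le_mul_of_nonneg_left hpp hD)
        have c2 : ⟪w, (y - p') - (x - p)⟫ ≤ M * e :=
          (real_inner_le_norm _ _).trans (mul_le_mul hwM hdev (norm_nonneg _) hM0)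
        linarith
      have a3 : ⟪w', x - y⟫ ≤ D * (2 * S s + 2 * e ^ 2) + M * e := by
        have : x - y = (p - p') + -((y - p') - (x - p)) := by module
        rw [this, inner_add_right]
        have c1 := (hq' p hp).trans (mul_le_mul_of_nonneg_left
          ((norm_sub_rev p p') ▸ hpp) hD)
        have c2 : ⟪w', -((y - p') - (x - p))⟫ ≤ M * e :=
          (real_inner_le_norm _ _).trans
            (mul_le_mul hwM' (by rwa [norm_neg]) (norm_nonneg _) hM0)
        linarith
      have hexp : ⟪x - y, F i s (X s) - w - (F i s (Y s) - w')⟫ =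
          ⟪x - y, F i s (X s) - F i s (Y s)⟫ + ⟪w, y - x⟫ + ⟪w', x - y⟫ := by
        rw [real_inner_comm (x - y) w', ← neg_sub x y, inner_neg_right,
          real_inner_comm (x - y) w]
        simp only [inner_sub_right]
        ring
      rw [hexp, hE]
      nlinarith
  intro t ht
  refine (hnsq t).trans (int_gronwall hT (by positivity) (by positivity) hSc (fun t ht => ?_) t ht)
  calc S t ≤ ∑ _i : Fin n, ∫ s in (0:ℝ)..t, ((2 * L + 8 * D) * S s + E) :=
        Finset.sum_le_sum fun i _ => key i t ht
    _ = n * ∫ s in (0:ℝ)..t, ((2 * L + 8 * D) * S s + E) := by simp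
    _ = _ := by
      rw [← intervalIntegral.integral_const_mul]
      congr 1; ext s; ring

lemma cone_dir {w x u : Pt m} {D : ℝ}
    (h : ∀ q ∈ closure Ω, ⟪w, q - x⟫ ≤ D * ‖q - x‖ ^ 2)
    (hu : ∀ᶠ r : ℝ in 𝓝[>] 0, x + r • u ∈ closure Ω) : ⟪w, u⟫ ≤ 0 := by
  have h1 : ∀ᶠ r : ℝ in 𝓝[>] 0, ⟪w, u⟫ ≤ D * r * ‖u‖ ^ 2 := by
    filter_upwards [hu, self_mem_nhdsWithin] with r hr hr0
    have hr0' : (0:ℝ) < r := hr0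
    have := h _ hr
    rw [add_sub_cancel_left, real_inner_smul_right, norm_smul, Real.norm_of_nonneg hr0'.le] at this
    have h2 : r * ⟪w, u⟫ ≤ r * (D * r * ‖u‖ ^ 2) := by linarith
    exact le_of_mul_le_mul_left h2 hr0'
  have h2 : Tendsto (fun r : ℝ => D * r * ‖u‖ ^ 2) (𝓝[>] 0) (𝓝 0) := by
    have : Continuous (fun r : ℝ => D * r * ‖u‖ ^ 2) := by fun_prop
    simpa using (this.tendsto 0).mono_left nhdsWithin_le_nhds
  exact ge_of_tendsto h2 h1

lemma cone_interior (hO : IsOpen Ω) {w x : Pt m} {D : ℝ} (hx : x ∈ Ω)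
    (h : ∀ q ∈ closure Ω, ⟪w, q - x⟫ ≤ D * ‖q - x‖ ^ 2) : w = 0 := by
  have := cone_dir (u := w) h (by
    have hc : Continuous (fun r : ℝ => x + r • w) := by fun_prop
    have := hc.tendsto 0
    simp only [zero_smul, add_zero] at this
    filter_upwards [(this.mono_left nhdsWithin_le_nhds).eventually (hO.mem_nhds hx)] with r hr
    exact subset_closure hr)
  rw [real_inner_self_eq_norm_sq] at this
  rw [← norm_eq_zero]
  exact pow_eq_zero_iff two_ne_zero |>.1 (le_antisymm this (sq_nonneg _))

lemma cone_boundary (hΩ : IsC2Domain Ω ν) {w x : Pt m} {D : ℝ} (hx : x ∈ frontier Ω)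
    (h : ∀ q ∈ closure Ω, ⟪w, q - x⟫ ≤ D * ‖q - x‖ ^ 2) :
    0 ≤ ⟪w, ν x⟫ ∧ w = ⟪w, ν x⟫ • ν x := by
  have hν := hΩ.normal_unit x hx
  have hνν : ⟪ν x, ν x⟫ = 1 := by rw [real_inner_self_eq_norm_sq, hν]; norm_num
  have hdir : ∀ u, ⟪ν x, u⟫ < 0 → ⟪w, u⟫ ≤ 0 := fun u hu => cone_dir h (inward_mem hΩ hx hu)
  constructor
  · have := hdir (-ν x) (by rw [inner_neg_right, hνν]; norm_num)
    rw [inner_neg_right] at this; linarith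
  · set c := ⟪w, ν x⟫ with hc
    have h1 : ∀ δ : ℝ, 0 < δ → ‖w - c • ν x‖ ^ 2 ≤ δ * c := by
      intro δ hδ
      have := hdir (w - c • ν x - δ • ν x) (by
        rw [inner_sub_right, inner_sub_right, real_inner_smul_right, real_inner_smul_right, hνν,
          real_inner_comm, ← hc]
        linarith)
      rw [inner_sub_right, inner_sub_right, real_inner_smul_right, real_inner_smul_right,
        ← hc, real_inner_self_eq_norm_sq] at this
      rw [norm_sub_sq_real, real_inner_smul_right, ← hc, norm_smul, hν, mul_one, Real.norm_eq_abs,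
        sq_abs]
      linarith
    have h2 : Tendsto (fun δ : ℝ => δ * c) (𝓝[>] 0) (𝓝 0) := by
      have : Continuous (fun r : ℝ => r * c) := by fun_prop
      simpa using (this.tendsto 0).mono_left nhdsWithin_le_nhds
    have h3 := ge_of_tendsto h2 (by
      filter_upwards [self_mem_nhdsWithin] with r hr
      exact h1 r hr)
    rw [← sub_eq_zero, ← norm_eq_zero]
    exact pow_eq_zero_iff two_ne_zero |>.1 (le_antisymm h3 (sq_nonneg _))

lemma limit_evi {F : Fin n → ℝ → Conf m n → Pt m} {T M D : ℝ}
    (hFc : ∀ i, Continuous (Function.uncurry (F i)))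
    (hM0 : 0 ≤ M) (hD : 0 ≤ D) {X0 : Conf m n} {η : ℕ → ℝ} (hη : ∀ j, 0 ≤ η j)
    (hη0 : Tendsto η atTop (𝓝 0)) {Xs : ℕ → ℝ → Conf m n} {X : ℝ → Conf m n}
    (hX : ∀ j, IsApprox Ω F T M D X0 (η j) (Xs j))
    (hu : TendstoUniformlyOn Xs X atTop (Icc 0 T))
    {i : Fin n} {t : ℝ} (ht : t ∈ Ioo 0 T) (hXc : ContinuousWithinAt X (Icc 0 T) t)
    {v : Pt m} (hv : HasDerivAt (fun s => X s i) v t) :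
    ∀ q ∈ closure Ω, ⟪F i t (X t) - v, q - X t i⟫ ≤ D * ‖q - X t i‖ ^ 2 := by
  intro q hq
  have hIcc : Icc 0 T ∈ 𝓝 t := Icc_mem_nhds ht.1 ht.2
  set Ψ : ℝ × Conf m n × ℝ → ℝ := fun z =>
    -⟪F i z.1 z.2.1, q - z.2.1 i⟫ + D * (‖q - z.2.1 i‖ + z.2.2) ^ 2 + M * z.2.2 with hΨ
  have hΨc : Continuous Ψ := by
    have h1 : Continuous (fun z : ℝ × Conf m n × ℝ => F i z.1 z.2.1) :=
      (hFc i).comp (continuous_fst.prodMk (continuous_fst.comp continuous_snd))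
    fun_prop
  have htend : Tendsto (fun z : ℕ × ℝ => (z.2, Xs z.1 z.2, η z.1)) (atTop ×ˢ 𝓝 t)
      (𝓝 (t, X t, 0)) := by
    refine tendsto_snd.prodMk_nhds (Tendsto.prodMk_nhds ?_ (hη0.comp tendsto_fst))
    rw [Metric.tendsto_nhds]
    intro r hr
    have h1 := Metric.tendstoUniformlyOn_iff.1 hu (r / 2) (by positivity)
    have h2 := (Metric.tendsto_nhds.1 (hXc.continuousAt hIcc)) (r / 2) (by positivity)
    filter_upwards [h1.prod_mk (h2.and hIcc)] with z hz
    have a1 := hz.1 z.2 hz.2.2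
    have a2 := hz.2.1
    rw [dist_comm] at a1
    linarith [dist_triangle (Xs z.1 z.2) (X z.2) (X t)]
  have main : ∀ ρ : ℝ, 0 < ρ → -⟪v, q - X t i⟫ ≤ Ψ (t, X t, 0) + ρ := by
    intro ρ hρ
    set c := Ψ (t, X t, 0) + ρ with hc
    have hev := ((hΨc.tendsto _).comp htend).eventually
      (gt_mem_nhds (show Ψ (t, X t, 0) < c by linarith))
    rw [eventually_prod_iff] at hev
    obtain ⟨pa, hpa, pb, hpb, hab⟩ := hev
    obtain ⟨δ, hδ, hball⟩ := Metric.eventually_nhds_iff_ball.1 (hpb.and hIcc)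
    have hder : HasDerivAt (fun s => ‖q - X s i‖ ^ 2) (2 * ⟪q - X t i, -v⟫) t := by
      simpa using (hv.const_sub q).norm_sq
    have hsl := (hasDerivAt_iff_tendsto_slope_left_right.1 hder).2
    have hle : ∀ᶠ s in 𝓝[>] t, slope (fun s => ‖q - X s i‖ ^ 2) t s ≤ 2 * c := by
      have hIoo : ∀ᶠ s in 𝓝[>] t, s ∈ Ioo t (t + δ) := Ioo_mem_nhdsGT (by linarith)
      filter_upwards [hIoo] with s hs
      rw [slope_def_field, div_le_iff₀ (by linarith [hs.1])]
      have hmem : ∀ r ∈ Icc t s, pb r ∧ r ∈ Icc 0 T := fun r hr => hball r (by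
        rw [Metric.mem_ball, Real.dist_eq, abs_lt]
        constructor <;> linarith [hr.1, hr.2, hs.2])
      have hpt : ∀ r ∈ Icc 0 T, Tendsto (fun j => ‖q - Xs j r i‖ ^ 2) atTop
          (𝓝 (‖q - X r i‖ ^ 2)) := fun r hr => by
        have h1 := (continuous_apply i).continuousAt.tendsto.comp (hu.tendsto_at hr)
        exact ((tendsto_const_nhds.sub h1).norm).pow 2
      have hsI := (hmem s ⟨hs.1.le, le_rfl⟩).2
      have htI := (hmem t ⟨le_rfl, hs.1.le⟩).2
      refine le_of_tendsto ((hpt s hsI).sub (hpt t htI)) ?_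
      filter_upwards [hpa] with j hj
      have hsub : Icc t s ⊆ Icc 0 T := fun r hr => (hmem r hr).2
      have hlip : LipschitzOnWith (0 + (2 * M).toNNReal) (fun r => q - Xs j r i) (Icc t s) :=
        ((LipschitzWith.const q).lipschitzOnWith).sub
          ((lipOn_of hM0 ((hX j).lip i)).mono hsub)
      have := ae_mvt hs.1.le (ac_norm_sq hs.1.le hlip) (g := fun _ => 2 * c)
        intervalIntegrable_const ?_
      · refine this.trans (le_of_eq ?_)
        simp; ring
      · filter_upwards [(hX j).ode i] with r hr hrI
        have hr2 := hmem r (Ioo_subset_Icc_self hrI)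
        obtain ⟨w, p, hw, hwM, hp, hpη, hqw⟩ :=
          hr ⟨htI.1.trans_lt hrI.1, hrI.2.trans_le hsI.2⟩
        refine ⟨_, (hw.const_sub q).norm_sq, ?_⟩
        have hΨr : Ψ (r, Xs j r, η j) < c := hab hj hr2.1
        rw [hΨ] at hΨr
        simp only at hΨr
        have b1 : ⟪w, q - p⟫ ≤ D * (‖q - Xs j r i‖ + η j) ^ 2 := by
          refine (hqw q hq).trans ?_
          have : ‖q - p‖ ≤ ‖q - Xs j r i‖ + η j := by
            have := norm_sub_le_norm_sub_add_norm_sub q (Xs j r i) p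
            linarith
          gcongr
        have b2 : ⟪w, p - Xs j r i⟫ ≤ M * η j :=
          (real_inner_le_norm _ _).trans
            (mul_le_mul hwM (by rwa [norm_sub_rev]) (norm_nonneg _) hM0)
        have b3 : ⟪q - Xs j r i, -(F i r (Xs j r) - w)⟫ =
            -⟪F i r (Xs j r), q - Xs j r i⟫ + (⟪w, q - p⟫ + ⟪w, p - Xs j r i⟫) := by
          rw [← inner_add_right, sub_add_sub_cancel, inner_neg_right, inner_sub_right,
            real_inner_comm, real_inner_comm w]
          ring
        rw [b3]
        linarith
    have h5 := le_of_tendsto hsl hle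
    rw [inner_neg_right, real_inner_comm] at h5
    linarith
  have := le_of_forall_pos_le_add main
  simp only [hΨ, add_zero, mul_zero] at this
  rw [inner_sub_left]
  linarith

end analysis

section penal

variable {Ω : Set (Pt m)} {ν : Pt m → Pt m}

lemma hasDeriv_Ici {E : Type*} [NormedAddCommGroup E] [NormedSpace ℝ E] {x : ℝ → E} {v : E}
    {T t : ℝ} (ht : t ∈ Ico 0 T) (h : HasDerivWithinAt x v (Icc 0 T) t) :
    HasDerivWithinAt x v (Ici t) t :=
  h.mono_of_mem_nhdsWithin (Icc_mem_nhdsGE_of_mem ht)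

lemma barrier (hΩ : IsC2Domain Ω ν) {ε : ℝ} (hε : 0 < ε)
    (hd2 : ∀ x ∈ closure (Metric.thickening ε Ω) \ closure Ω, ContDiffAt ℝ 2 (distCl Ω) x)
    {x : ℝ → Pt m} {T M k : ℝ} (hM0 : 0 ≤ M) (hk : M / ε < k) {g : ℝ → Pt m}
    (hg : ∀ t ∈ Icc (0:ℝ) T, ‖g t‖ ≤ M) {h : Pt m → Pt m}
    (hh : ∀ x, distCl Ω x ≤ ε → h x = dGradd Ω x) (hx0 : x 0 ∈ closure Ω)
    (hx : ∀ t ∈ Icc (0:ℝ) T, HasDerivWithinAt x (g t - k • h (x t)) (Icc 0 T) t) :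
    ∀ t ∈ Icc (0:ℝ) T, distCl Ω (x t) ≤ M / k := by
  obtain ⟨C, hC0, hC⟩ := exists_prox_const hΩ
  have hk0 : 0 < k := lt_of_le_of_lt (by positivity) hk
  have hMk : M / k < ε := by
    rw [div_lt_iff₀ hε] at hk
    rw [div_lt_iff₀ hk0]; linarith
  have hp : ∀ t, ∃ p ∈ closure Ω, distCl Ω (x t) = ‖x t - p‖ ∧
      (distCl Ω (x t) ≤ ε → h (x t) = x t - p) := by
    intro t
    by_cases hd : distCl Ω (x t) ≤ ε
    · obtain ⟨p, hp, h1, h2, -⟩ := geo hΩ hε hd2 hC hd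
      exact ⟨p, hp, h2, fun _ => (hh _ hd).trans h1⟩
    · obtain ⟨p, hp, h2⟩ := exists_nearest hΩ.nonempty (x t)
      exact ⟨p, hp, h2, fun h => absurd h hd⟩
  choose p hpc hpd hph using hp
  have key : ∀ c, M / k < c → c ≤ ε → ∀ t ∈ Icc (0:ℝ) T, distCl Ω (x t) ^ 2 ≤ c ^ 2 := by
    intro c hc hcε t ht
    have hc0 : 0 < c := lt_of_le_of_lt (by positivity) hc
    refine image_le_of_liminf_slope_right_lt_deriv_boundary'
      (f := fun t => distCl Ω (x t) ^ 2)
      (f' := fun t => 2 * ⟪x t - p t, g t - k • h (x t)⟫) (B := fun _ => c ^ 2)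
      (B' := fun _ => 0) ?_ ?_ ?_ continuousOn_const (fun _ _ => hasDerivWithinAt_const _ _ _)
      ?_ ht
    · exact (distCl_lip.continuous.comp_continuousOn
        (fun t ht => (hx t ht).continuousWithinAt)).pow 2
    · intro t ht r hr
      have h1 : HasDerivWithinAt (fun s => ‖x s - p t‖ ^ 2)
          (2 * ⟪x t - p t, g t - k • h (x t)⟫) (Ici t) t :=
        ((hasDeriv_Ici ht (hx t (Ico_subset_Icc_self ht))).sub_const (p t)).norm_sq
      refine ((h1.liminf_right_slope_le hr).and_eventually self_mem_nhdsWithin).mono ?_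
      rintro z ⟨hz, hz1⟩
      have hz2 : t < z := hz1
      refine lt_of_le_of_lt ?_ hz
      rw [slope_def_field, slope_def_field]
      have : 0 < z - t := by linarith
      have h3 := distCl_le (hpc t) (x z)
      have h4 := distCl_nonneg (Ω := Ω) (x z)
      simp only [hpd t]
      gcongr
    · simpa [distCl_eq_zero hx0] using sq_nonneg c
    · intro t ht heq
      have hd : distCl Ω (x t) = c := by
        have := distCl_nonneg (Ω := Ω) (x t)
        exact (sq_eq_sq₀ this hc0.le).1 heq
      rw [hph t (hd.le.trans hcε), inner_sub_right, real_inner_smul_right,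
        real_inner_self_eq_norm_sq, ← hpd t, hd]
      have h1 : ⟪x t - p t, g t⟫ ≤ c * M := by
        refine (real_inner_le_norm _ _).trans ?_
        rw [← hpd t, hd]
        have := hg t (Ico_subset_Icc_self ht)
        gcongr
      rw [div_lt_iff₀ hk0] at hc
      nlinarith
  intro t ht
  refine le_of_forall_gt_imp_ge_of_dense fun c hc => ?_
  by_contra! hcon
  have h1 := key (min c ε) (lt_min hc hMk) (min_le_right _ _) t ht
  have h2 : 0 < min c ε := lt_min (lt_of_le_of_lt (by positivity) hc) hε
  have := (sq_le_sq₀ (distCl_nonneg _) h2.le).1 h1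
  linarith [min_le_left c ε]

lemma exists_ext (hΩ : IsC2Domain Ω ν) {ε : ℝ} (hε : 0 < ε)
    (hd2 : ∀ x ∈ closure (Metric.thickening ε Ω) \ closure Ω, ContDiffAt ℝ 2 (distCl Ω) x) :
    ∃ (h : Pt m → Pt m) (K : ℝ≥0) (R : ℝ), LipschitzWith K h ∧ 0 ≤ R ∧ (∀ x, ‖h x‖ ≤ R) ∧
      ∀ x, distCl Ω x ≤ ε → h x = dGradd Ω x := by
  obtain ⟨C, hC0, hC⟩ := exists_prox_const hΩ
  obtain ⟨K, hK⟩ := dGradd_lip hΩ hε hd2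
  obtain ⟨g, hg, hge⟩ := hK.extend_finite_dimension
  set c : ℝ → ℝ := fun a => max (-ε) (min ε a) with hc
  have hcl : ∀ a b, |c a - c b| ≤ |a - b| := fun a b => by
    simp only [hc]
    refine (abs_max_sub_max_le_max _ _ _ _).trans ?_
    refine max_le (by simp) ((abs_min_sub_min_le_max _ _ _ _).trans ?_)
    exact max_le (by simp) le_rfl
  have hcb : ∀ a, |c a| ≤ ε := fun a => by
    rw [abs_le]
    exact ⟨le_max_left _ _, max_le (by linarith) (min_le_left _ _)⟩
  have hce : ∀ a, |a| ≤ ε → c a = a := fun a ha => by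
    rw [abs_le] at ha
    simp only [hc]
    rw [min_eq_right ha.2, max_eq_right ha.1]
  refine ⟨fun x => WithLp.toLp 2 (fun j => c (g x j)), lipschitzExtensionConstant (Pt m) * K,
    √(∑ _j : Fin m, ε ^ 2), ?_, Real.sqrt_nonneg _, ?_, ?_⟩
  · refine LipschitzWith.of_dist_le_mul fun x y => le_trans ?_ (hg.dist_le_mul x y)
    rw [EuclideanSpace.dist_eq, EuclideanSpace.dist_eq]
    refine Real.sqrt_le_sqrt (Finset.sum_le_sum fun j _ => ?_)
    simp only [Real.dist_eq]
    exact pow_le_pow_left₀ (abs_nonneg _) (hcl _ _) 2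
  · intro x
    rw [EuclideanSpace.norm_eq]
    refine Real.sqrt_le_sqrt (Finset.sum_le_sum fun j _ => ?_)
    simp only [Real.norm_eq_abs]
    gcongr
    exact hcb _
  · intro x hx
    rw [hge (show x ∈ {x | distCl Ω x ≤ ε} from hx)]
    ext j
    refine hce _ ?_
    rw [← hge (show x ∈ {x | distCl Ω x ≤ ε} from hx)]
    obtain ⟨p, hp, h1, h2, -⟩ := geo hΩ hε hd2 hC hx
    rw [h1]
    exact (PiLp.norm_apply_le (x - p) j).trans (h2 ▸ hx)

lemma penal_near (hΩ : IsC2Domain Ω ν) {ε : ℝ} (hε : 0 < ε)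
    (hd2 : ∀ x ∈ closure (Metric.thickening ε Ω) \ closure Ω, ContDiffAt ℝ 2 (distCl Ω) x)
    {T : ℝ} {F : Fin n → ℝ → Conf m n → Pt m} {M : ℝ} (hM0 : 0 ≤ M)
    (hM : ∀ i, ∀ t ∈ Icc (0:ℝ) T, ∀ X : Conf m n, ‖F i t X‖ ≤ M)
    {X0 : Conf m n} (hX0 : X0 ∈ Gset Ω n) {k : ℝ} (hk : M / ε < k) {X : ℝ → Conf m n}
    (hX : IsPenalSol Ω F T k X0 X) (i : Fin n) :
    ∀ t ∈ Icc (0:ℝ) T, distCl Ω (X t i) ≤ M / k :=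
  barrier hΩ hε hd2 hM0 hk (g := fun t => F i t (X t)) (fun t ht => hM i t ht _)
    (h := dGradd Ω) (fun _ _ => rfl) (by rw [hX.1]; exact hX0 i) (hX.2 i)

lemma div_lt_eps {M ε k : ℝ} (hM0 : 0 ≤ M) (hε : 0 < ε) (hk : M / ε < k) :
    0 < k ∧ M / k < ε := by
  have hk0 : 0 < k := lt_of_le_of_lt (by positivity) hk
  refine ⟨hk0, ?_⟩
  rw [div_lt_iff₀ hε] at hk
  rw [div_lt_iff₀ hk0]; linarith

lemma penal_unique (hΩ : IsC2Domain Ω ν) {ε : ℝ} (hε : 0 < ε)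
    (hd2 : ∀ x ∈ closure (Metric.thickening ε Ω) \ closure Ω, ContDiffAt ℝ 2 (distCl Ω) x)
    {T : ℝ} {F : Fin n → ℝ → Conf m n → Pt m} {M : ℝ} (hM0 : 0 ≤ M)
    (hM : ∀ i, ∀ t ∈ Icc (0:ℝ) T, ∀ X : Conf m n, ‖F i t X‖ ≤ M) {L : ℝ} (hL : 0 < L)
    (hLip : ∀ i, ∀ t ∈ Icc (0:ℝ) T, ∀ X Y : Conf m n,
      ‖F i t X - F i t Y‖ ≤ L * ‖X - Y‖)
    {X0 : Conf m n} (hX0 : X0 ∈ Gset Ω n) {k : ℝ} (hk : M / ε < k) {X Y : ℝ → Conf m n}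
    (hX : IsPenalSol Ω F T k X0 X) (hY : IsPenalSol Ω F T k X0 Y) :
    ∀ t ∈ Icc (0:ℝ) T, Y t = X t := by
  obtain ⟨K, hK⟩ := dGradd_lip hΩ hε hd2
  obtain ⟨hk0, hkε⟩ := div_lt_eps hM0 hε hk
  have hder : ∀ {Z}, IsPenalSol Ω F T k X0 Z → ∀ t ∈ Icc 0 T, HasDerivWithinAt Z
      ((fun t Z i => F i t Z - k • dGradd Ω (Z i)) t (Z t)) (Icc 0 T) t := by
    intro Z hZ t ht
    rw [hasDerivWithinAt_pi]
    exact fun i => hZ.2 i t ht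
  have hmem : ∀ {Z}, IsPenalSol Ω F T k X0 Z → ∀ t ∈ Ico 0 T,
      Z t ∈ ((fun _ => {Z | ∀ i, distCl Ω (Z i) ≤ ε}) : ℝ → Set (Conf m n)) t := by
    intro Z hZ t ht i
    exact (penal_near hΩ hε hd2 hM0 hM hX0 hk hZ i t (Ico_subset_Icc_self ht)).trans hkε.le
  refine ODE_solution_unique_of_mem_Icc_right
    (v := fun t Z i => F i t Z - k • dGradd Ω (Z i))
    (s := fun _ => {Z | ∀ i, distCl Ω (Z i) ≤ ε}) (K := L.toNNReal + k.toNNReal * K) ?_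
    (fun t ht => (hder hY t ht).continuousWithinAt)
    (fun t ht => hasDeriv_Ici ht (hder hY t (Ico_subset_Icc_self ht))) (hmem hY)
    (fun t ht => (hder hX t ht).continuousWithinAt)
    (fun t ht => hasDeriv_Ici ht (hder hX t (Ico_subset_Icc_self ht))) (hmem hX)
    (by rw [hX.1, hY.1])
  intro t ht
  refine LipschitzOnWith.of_dist_le_mul fun Z hZ W hW => ?_
  rw [dist_eq_norm, dist_eq_norm, pi_norm_le_iff_of_nonneg (by positivity)]
  intro i
  have h1 := hLip i t (Ico_subset_Icc_self ht) Z W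
  have h2 := hK.dist_le_mul (Z i) (hZ i) (W i) (hW i)
  rw [dist_eq_norm, dist_eq_norm] at h2
  have h3 : ‖Z i - W i‖ ≤ ‖Z - W‖ := norm_le_pi_norm (Z - W) i
  have h4 : (F i t Z - k • dGradd Ω (Z i)) - (F i t W - k • dGradd Ω (W i)) =
    (F i t Z - F i t W) - k • (dGradd Ω (Z i) - dGradd Ω (W i)) := by module
  simp only [Pi.sub_apply]
  rw [h4]
  refine (norm_sub_le _ _).trans ?_
  rw [norm_smul, Real.norm_of_nonneg hk0.le]
  push_cast
  rw [Real.coe_toNNReal _ hL.le, Real.coe_toNNReal _ hk0.le]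
  have h5 : ‖dGradd Ω (Z i) - dGradd Ω (W i)‖ ≤ K * ‖Z - W‖ := h2.trans (by gcongr)
  have h6 := mul_le_mul_of_nonneg_left h5 hk0.le
  linarith

lemma penal_exists (hΩ : IsC2Domain Ω ν) {ε : ℝ} (hε : 0 < ε)
    (hd2 : ∀ x ∈ closure (Metric.thickening ε Ω) \ closure Ω, ContDiffAt ℝ 2 (distCl Ω) x)
    {T : ℝ} (hT : 0 < T) {F : Fin n → ℝ → Conf m n → Pt m}
    (hFc : ∀ i, Continuous (Function.uncurry (F i))) {M : ℝ} (hM0 : 0 ≤ M)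
    (hM : ∀ i, ∀ t ∈ Icc (0:ℝ) T, ∀ X : Conf m n, ‖F i t X‖ ≤ M) {L : ℝ} (hL : 0 < L)
    (hLip : ∀ i, ∀ t ∈ Icc (0:ℝ) T, ∀ X Y : Conf m n,
      ‖F i t X - F i t Y‖ ≤ L * ‖X - Y‖)
    {X0 : Conf m n} (hX0 : X0 ∈ Gset Ω n) {k : ℝ} (hk : M / ε < k) :
    ∃ X, IsPenalSol Ω F T k X0 X := by
  obtain ⟨h, K, R, hK, hR0, hR, hh⟩ := exists_ext hΩ hε hd2
  obtain ⟨hk0, hkε⟩ := div_lt_eps hM0 hε hk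
  have hPL : IsPicardLindelof (fun t (Z : Conf m n) i => F i t Z - k • h (Z i))
      (tmin := 0) (tmax := T) ⟨0, le_rfl, hT.le⟩ X0 ((M + k * R) * T).toNNReal 0
      (M + k * R).toNNReal (L.toNNReal + k.toNNReal * K) := by
    constructor
    · intro t ht
      refine LipschitzOnWith.of_dist_le_mul fun Z hZ W hW => ?_
      rw [dist_eq_norm, dist_eq_norm, pi_norm_le_iff_of_nonneg (by positivity)]
      intro i
      have h1 := hLip i t ht Z W
      have h2 := hK.dist_le_mul (Z i) (W i)
      rw [dist_eq_norm, dist_eq_norm] at h2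
      have h3 : ‖Z i - W i‖ ≤ ‖Z - W‖ := norm_le_pi_norm (Z - W) i
      have h4 : (F i t Z - k • h (Z i)) - (F i t W - k • h (W i)) =
        (F i t Z - F i t W) - k • (h (Z i) - h (W i)) := by module
      simp only [Pi.sub_apply]
      rw [h4]
      refine (norm_sub_le _ _).trans ?_
      rw [norm_smul, Real.norm_of_nonneg hk0.le]
      push_cast
      rw [Real.coe_toNNReal _ hL.le, Real.coe_toNNReal _ hk0.le]
      have h5 : ‖h (Z i) - h (W i)‖ ≤ K * ‖Z - W‖ := h2.trans (by gcongr)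
      have h6 := mul_le_mul_of_nonneg_left h5 hk0.le
      linarith
    · intro Z _
      refine Continuous.continuousOn (continuous_pi fun i => ?_)
      have : Continuous (fun t => F i t Z) := (hFc i).comp (continuous_id.prodMk continuous_const)
      fun_prop
    · intro t ht Z _
      rw [Real.coe_toNNReal _ (by positivity), pi_norm_le_iff_of_nonneg (by positivity)]
      intro i
      refine (norm_sub_le _ _).trans ?_
      rw [norm_smul, Real.norm_of_nonneg hk0.le]
      have := hM i t ht Z
      have := hR (Z i)
      gcongr
    · simp only [sub_zero, NNReal.coe_zero]
      rw [Real.coe_toNNReal _ (by positivity), Real.coe_toNNReal _ (by positivity)]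
      simp [hT.le]
  obtain ⟨X, hX1, hX2⟩ := hPL.exists_eq_forall_mem_Icc_hasDerivWithinAt₀
  simp only at hX1
  have hd : ∀ i, ∀ t ∈ Icc 0 T, HasDerivWithinAt (fun s => X s i)
      (F i t (X t) - k • h (X t i)) (Icc 0 T) t := fun i t ht =>
    hasDerivWithinAt_pi.1 (hX2 t ht) i
  refine ⟨X, hX1, fun i t ht => ?_⟩
  have hb := barrier hΩ hε hd2 hM0 hk (g := fun t => F i t (X t)) (fun t ht => hM i t ht _)
    (h := h) hh (by rw [hX1]; exact hX0 i) (hd i) t ht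
  rw [← hh _ (hb.trans hkε.le)]
  exact hd i t ht

lemma penal_approx (hΩ : IsC2Domain Ω ν) {ε : ℝ} (hε : 0 < ε)
    (hd2 : ∀ x ∈ closure (Metric.thickening ε Ω) \ closure Ω, ContDiffAt ℝ 2 (distCl Ω) x)
    {C : ℝ} (hC0 : 0 ≤ C)
    (hC : ∀ p ∈ frontier Ω, ∀ q ∈ closure Ω, ⟪ν p, q - p⟫ ≤ C * ‖q - p‖ ^ 2)
    {T : ℝ} {F : Fin n → ℝ → Conf m n → Pt m} {M : ℝ} (hM0 : 0 ≤ M)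
    (hM : ∀ i, ∀ t ∈ Icc (0:ℝ) T, ∀ X : Conf m n, ‖F i t X‖ ≤ M)
    {X0 : Conf m n} (hX0 : X0 ∈ Gset Ω n) {k : ℝ} (hk : M / ε < k) {X : ℝ → Conf m n}
    (hX : IsPenalSol Ω F T k X0 X) : IsApprox Ω F T M (M * C) X0 (M / k) X := by
  obtain ⟨hk0, hkε⟩ := div_lt_eps hM0 hε hk
  have hnear := fun i => penal_near hΩ hε hd2 hM0 hM hX0 hk hX i
  have hg : ∀ i, ∀ t ∈ Icc 0 T, ∃ p ∈ closure Ω, dGradd Ω (X t i) = X t i - p ∧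
      ‖X t i - p‖ ≤ M / k ∧ ‖k • dGradd Ω (X t i)‖ ≤ M ∧
      ∀ q ∈ closure Ω, ⟪k • dGradd Ω (X t i), q - p⟫ ≤ M * C * ‖q - p‖ ^ 2 := by
    intro i t ht
    have hn := hnear i t ht
    obtain ⟨p, hp, h1, h2, h3⟩ := geo hΩ hε hd2 hC (hn.trans hkε.le)
    have hkd : k * distCl Ω (X t i) ≤ M := by
      rw [le_div_iff₀ hk0] at hn; linarith
    refine ⟨p, hp, h1, h2 ▸ hn, ?_, ?_⟩
    · rw [h1, norm_smul, Real.norm_of_nonneg hk0.le, ← h2]; exact hkd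
    · intro q hq
      rw [h1, real_inner_smul_left]
      calc k * ⟪X t i - p, q - p⟫ ≤ k * (distCl Ω (X t i) * (C * ‖q - p‖ ^ 2)) :=
            mul_le_mul_of_nonneg_left (h3 q hq) hk0.le
        _ = (k * distCl Ω (X t i)) * (C * ‖q - p‖ ^ 2) := by ring
        _ ≤ M * (C * ‖q - p‖ ^ 2) := by gcongr
        _ = _ := by ring
  refine ⟨hX.1, ?_, hnear, ?_⟩
  · intro i s hs t ht
    have := Convex.norm_image_sub_le_of_norm_hasDerivWithin_le (C := 2 * M) (hX.2 i) (fun r hr => by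
      obtain ⟨p, hp, -, -, h, -⟩ := hg i r hr
      have h1 := norm_sub_le (F i r (X r)) (k • dGradd Ω (X r i))
      have := hM i r hr (X r)
      linarith) (convex_Icc 0 T) ht hs
    simpa using this
  · intro i
    refine Eventually.of_forall fun t ht => ?_
    obtain ⟨p, hp, h1, h2, h3, h4⟩ := hg i t (Ioo_subset_Icc_self ht)
    exact ⟨_, p, (hX.2 i t (Ioo_subset_Icc_self ht)).hasDerivAt (Icc_mem_nhds ht.1 ht.2),
      h3, hp, h2, h4⟩

end penal
section mild

variable {Ω : Set (Pt m)} {ν : Pt m → Pt m}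

lemma normal_contOn (hΩ : IsC2Domain Ω ν) : ContinuousOn ν (frontier Ω) := by
  have : ContinuousOn (gradient (sgnDist Ω)) (frontier Ω) := fun x hx =>
    (gradient_contDiffAt (hΩ.smoothBoundary x hx)).continuousAt.continuousWithinAt
  exact this.congr fun x hx => (hΩ.grad_eq_normal x hx).symm

open Classical in
lemma oneProj_eq (x f : Pt m) : oneProj Ω ν x f =
    f - (max ⟪f, (frontier Ω).piecewise ν 0 x⟫ 0) • (frontier Ω).piecewise ν 0 x := by
  unfold oneProj
  by_cases hx : x ∈ frontier Ω
  · by_cases hf : 0 < ⟪f, ν x⟫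
    · simp [hx, hf, max_eq_left hf.le]
    · simp [hx, hf, max_eq_right (not_lt.1 hf)]
  · simp [hx]

lemma oneProj_norm_le (hΩ : IsC2Domain Ω ν) (x f : Pt m) : ‖oneProj Ω ν x f‖ ≤ ‖f‖ := by
  unfold oneProj
  split_ifs with h
  · have hν := hΩ.normal_unit x h.1
    refine (sq_le_sq₀ (norm_nonneg _) (norm_nonneg _)).1 ?_
    rw [norm_sub_sq_real, real_inner_smul_right, norm_smul, hν, mul_one, Real.norm_eq_abs, sq_abs]
    nlinarith [sq_nonneg ⟪f, ν x⟫]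
  · exact le_rfl

lemma oneProj_react (hΩ : IsC2Domain Ω ν) {C M : ℝ} (hC0 : 0 ≤ C)
    (hC : ∀ p ∈ frontier Ω, ∀ q ∈ closure Ω, ⟪ν p, q - p⟫ ≤ C * ‖q - p‖ ^ 2)
    {x f : Pt m} (hf : ‖f‖ ≤ M) :
    ‖f - oneProj Ω ν x f‖ ≤ M ∧
      ∀ q ∈ closure Ω, ⟪f - oneProj Ω ν x f, q - x⟫ ≤ M * C * ‖q - x‖ ^ 2 := by
  have hM0 : 0 ≤ M := (norm_nonneg _).trans hf
  unfold oneProj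
  split_ifs with h
  · have hν := hΩ.normal_unit x h.1
    have h1 : ⟪f, ν x⟫ ≤ M := by
      have := real_inner_le_norm f (ν x)
      rw [hν] at this; linarith
    rw [sub_sub_cancel]
    refine ⟨?_, fun q hq => ?_⟩
    · rw [norm_smul, hν, Real.norm_of_nonneg h.2.le]; linarith
    · rw [real_inner_smul_left]
      have h2 := hC x h.1 q hq
      have h3 : 0 ≤ C * ‖q - x‖ ^ 2 := by positivity
      calc _ ≤ ⟪f, ν x⟫ * (C * ‖q - x‖ ^ 2) := mul_le_mul_of_nonneg_left h2 h.2.le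
        _ ≤ M * (C * ‖q - x‖ ^ 2) := mul_le_mul_of_nonneg_right h1 h3
        _ = _ := by ring
  · refine ⟨by simpa using hM0, fun q hq => ?_⟩
    simp only [sub_self, inner_zero_left]
    positivity

lemma proj_intble (hΩ : IsC2Domain Ω ν) {T : ℝ} (hT : 0 ≤ T) {F : Fin n → ℝ → Conf m n → Pt m}
    (hFc : ∀ i, Continuous (Function.uncurry (F i))) {X : ℝ → Conf m n}
    (hX : ContinuousOn X (Icc 0 T)) (i : Fin n) :
    IntervalIntegrable (fun s => oneProj Ω ν (X s i) (F i s (X s))) volume 0 T := by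
  classical
  set Y : ℝ → Conf m n := IccExtend hT ((Icc 0 T).domRestrict X) with hY
  have hYc : Continuous Y := (continuousOn_iff_continuous_domRestrict.1 hX).Icc_extend'
  have hYe : ∀ t ∈ Icc (0:ℝ) T, Y t = X t := fun t ht => by
    rw [hY, IccExtend_of_mem _ _ ht, domRestrict_apply]
  have hF : Continuous (fun s => F i s (Y s)) := (hFc i).comp (continuous_id.prodMk hYc)
  have hN : Measurable (fun s => (frontier Ω).piecewise ν 0 (Y s i)) := by
    refine Measurable.comp (g := (frontier Ω).piecewise ν 0) ?_
      (show Continuous (fun s => Y s i) by fun_prop).measurable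
    exact (normal_contOn hΩ).measurable_piecewise continuousOn_const
      isClosed_frontier.measurableSet
  have hm : Measurable (fun s => oneProj Ω ν (Y s i) (F i s (Y s))) := by
    simp only [oneProj_eq]
    have := hF.measurable
    fun_prop
  have h1 : IntervalIntegrable (fun s => oneProj Ω ν (Y s i) (F i s (Y s))) volume 0 T :=
    (hF.intervalIntegrable 0 T).mono_fun hm.aestronglyMeasurable
      (Eventually.of_forall fun s => oneProj_norm_le hΩ _ _)
  refine h1.congr fun s hs => ?_
  rw [uIoc_of_le hT] at hs
  simp only [hYe s ⟨hs.1.le, hs.2⟩]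

lemma proj_int_lip (hΩ : IsC2Domain Ω ν) {T : ℝ} (hT : 0 ≤ T)
    {F : Fin n → ℝ → Conf m n → Pt m}
    (hFc : ∀ i, Continuous (Function.uncurry (F i))) {M : ℝ}
    (hM : ∀ i, ∀ t ∈ Icc (0:ℝ) T, ∀ X : Conf m n, ‖F i t X‖ ≤ M) {X : ℝ → Conf m n}
    (hX : ContinuousOn X (Icc 0 T)) (i : Fin n) {s t : ℝ} (hs : s ∈ Icc 0 T) (ht : t ∈ Icc 0 T) :
    ‖(∫ r in (0:ℝ)..s, oneProj Ω ν (X r i) (F i r (X r))) -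
      ∫ r in (0:ℝ)..t, oneProj Ω ν (X r i) (F i r (X r))‖ ≤ M * |s - t| := by
  have hI := proj_intble hΩ hT hFc hX i
  have hIs : ∀ u ∈ Icc 0 T, IntervalIntegrable
      (fun s => oneProj Ω ν (X s i) (F i s (X s))) volume 0 u := fun u hu =>
    hI.mono_set (by rw [uIcc_of_le hu.1, uIcc_of_le hT]; exact Icc_subset_Icc le_rfl hu.2)
  rw [intervalIntegral.integral_interval_sub_left (hIs s hs) (hIs t ht)]
  refine intervalIntegral.norm_integral_le_of_norm_le_const fun r hr => ?_
  refine (oneProj_norm_le hΩ _ _).trans (hM i r ?_ _)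
  exact (convex_Icc (0:ℝ) T).ordConnected.uIcc_subset ht hs (uIoc_subset_uIcc hr)

lemma mild_approx (hΩ : IsC2Domain Ω ν) {C : ℝ} (hC0 : 0 ≤ C)
    (hC : ∀ p ∈ frontier Ω, ∀ q ∈ closure Ω, ⟪ν p, q - p⟫ ≤ C * ‖q - p‖ ^ 2)
    {T : ℝ} (hT : 0 ≤ T) {F : Fin n → ℝ → Conf m n → Pt m}
    (hFc : ∀ i, Continuous (Function.uncurry (F i))) {M : ℝ} (hM0 : 0 ≤ M)
    (hM : ∀ i, ∀ t ∈ Icc (0:ℝ) T, ∀ X : Conf m n, ‖F i t X‖ ≤ M)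
    {X0 : Conf m n} {X : ℝ → Conf m n}
    (hX : IsMildSol Ω ν F T X0 X) : IsApprox Ω F T M (M * C) X0 0 X := by
  obtain ⟨h1, h2, h3⟩ := hX
  have hXc : ContinuousOn X (Icc 0 T) := continuousOn_pi.2 h1
  refine ⟨?_, ?_, fun i t ht => (distCl_eq_zero (h2 t ht i)).le, ?_⟩
  · ext1 i
    rw [h3 0 ⟨le_rfl, hT⟩ i]; simp
  · intro i s hs t ht
    rw [h3 s hs i, h3 t ht i, add_sub_add_left_eq_sub]
    refine (proj_int_lip hΩ hT hFc hM hXc i hs ht).trans ?_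
    have : 0 ≤ M * |s - t| := by positivity
    linarith
  · intro i
    filter_upwards [(proj_intble (ν := ν) hΩ hT hFc hXc i).ae_hasDerivAt_integral] with t hd ht
    have htI := Ioo_subset_Icc_self ht
    rw [uIcc_of_le hT] at hd
    have hd := hd htI 0 ⟨le_rfl, hT⟩
    have hr := oneProj_react hΩ hC0 hC (x := X t i) (hM i t htI (X t))
    refine ⟨_, X t i, ?_, hr.1, h2 t htI i, by simp, hr.2⟩
    rw [sub_sub_cancel]
    refine (hd.const_add (X0 i)).congr_of_eventuallyEq ?_
    filter_upwards [Icc_mem_nhds ht.1 ht.2] with s hs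
    exact h3 s hs i

lemma deriv_eq_proj (hΩ : IsC2Domain Ω ν) {D : ℝ} {x f v : Pt m} (hx : x ∈ closure Ω)
    (h : ∀ q ∈ closure Ω, ⟪f - v, q - x⟫ ≤ D * ‖q - x‖ ^ 2)
    (hv : x ∈ frontier Ω → ⟪ν x, v⟫ = 0) : v = oneProj Ω ν x f := by
  by_cases hf : x ∈ frontier Ω
  · obtain ⟨a, b⟩ := cone_boundary hΩ hf h
    have hv := hv hf
    have hc : ⟪f - v, ν x⟫ = ⟪f, ν x⟫ := by
      rw [inner_sub_left, real_inner_comm (ν x) v, hv, sub_zero]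
    rw [hc] at a b
    unfold oneProj
    split_ifs with hp
    · rw [← b, sub_sub_cancel]
    · have : ⟪f, ν x⟫ = 0 := le_antisymm (not_lt.1 fun h => hp ⟨hf, h⟩) a
      rw [this, zero_smul, sub_eq_zero] at b
      exact b.symm
  · have hxi : x ∈ Ω := by
      rw [frontier, hΩ.isOpen.interior_eq] at hf
      by_contra hc
      exact hf ⟨hx, hc⟩
    have := cone_interior hΩ.isOpen hxi h
    rw [sub_eq_zero] at this
    simp [oneProj, hf, this]

lemma limit_mild (hΩ : IsC2Domain Ω ν) {D : ℝ} (hD : 0 ≤ D)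
    {T : ℝ} (hT : 0 ≤ T) {F : Fin n → ℝ → Conf m n → Pt m}
    (hFc : ∀ i, Continuous (Function.uncurry (F i))) {M : ℝ} (hM0 : 0 ≤ M)
    (hM : ∀ i, ∀ t ∈ Icc (0:ℝ) T, ∀ X : Conf m n, ‖F i t X‖ ≤ M)
    {X0 : Conf m n} {η : ℕ → ℝ} (hη : ∀ j, 0 ≤ η j)
    (hη0 : Tendsto η atTop (𝓝 0)) {Xs : ℕ → ℝ → Conf m n} {X : ℝ → Conf m n}
    (hX : ∀ j, IsApprox Ω F T M D X0 (η j) (Xs j))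
    (hu : TendstoUniformlyOn Xs X atTop (Icc 0 T)) : IsMildSol Ω ν F T X0 X := by
  have hpt : ∀ i, ∀ t ∈ Icc 0 T, Tendsto (fun j => Xs j t i) atTop (𝓝 (X t i)) :=
    fun i t ht => (continuous_apply i).continuousAt.tendsto.comp (hu.tendsto_at ht)
  have hinit : X 0 = X0 := by
    refine tendsto_nhds_unique (hu.tendsto_at ⟨le_rfl, hT⟩) ?_
    simp only [(hX _).init]
    exact tendsto_const_nhds
  have hlip : ∀ i, ∀ s ∈ Icc (0:ℝ) T, ∀ t ∈ Icc (0:ℝ) T, ‖X s i - X t i‖ ≤ 2 * M * |s - t| :=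
    fun i s hs t ht => le_of_tendsto ((hpt i s hs).sub (hpt i t ht)).norm
      (Eventually.of_forall fun j => (hX j).lip i s hs t ht)
  have hcl : ∀ t ∈ Icc (0:ℝ) T, ∀ i, X t i ∈ closure Ω := by
    intro t ht i
    refine mem_closure_of_distCl hΩ.nonempty (le_antisymm ?_ (distCl_nonneg _))
    exact le_of_tendsto_of_tendsto' ((distCl_lip.continuous.tendsto _).comp (hpt i t ht)) hη0
      (fun j => (hX j).near i t ht)
  have hlo := fun i => lipOn_of hM0 (hlip i)
  have hXc : ContinuousOn X (Icc 0 T) := continuousOn_pi.2 fun i => (hlo i).continuousOn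
  refine ⟨fun i => (hlo i).continuousOn, hcl, fun t ht i => ?_⟩
  set G : ℝ → Pt m := fun t => ∫ s in (0:ℝ)..t, oneProj Ω ν (X s i) (F i s (X s)) with hG
  have hGl : LipschitzOnWith M.toNNReal G (Icc 0 T) := by
    apply LipschitzOnWith.of_dist_le_mul
    intro s hs t ht
    rw [dist_eq_norm, Real.dist_eq, Real.coe_toNNReal _ hM0]
    exact proj_int_lip hΩ hT hFc hM hXc i hs ht
  have hl := (hlo i).sub hGl
  rw [← uIcc_of_le hT] at hl
  obtain ⟨c, hc⟩ := hl.absolutelyContinuousOnInterval.const_of_ae_hasDerivAt_zero (by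
    have e1 : ∀ᵐ r : ℝ, r ≠ 0 := by simp [ae_iff]
    have e2 : ∀ᵐ r : ℝ, r ≠ T := by simp [ae_iff]
    filter_upwards [(proj_intble (ν := ν) hΩ hT hFc hXc i).ae_hasDerivAt_integral,
      (hlo i).ae_differentiableWithinAt_of_mem_real, e1, e2] with r hd hdx h0 hT' hr
    have hd := hd hr 0 left_mem_uIcc
    rw [uIcc_of_le hT] at hr
    have hr' : r ∈ Ioo 0 T := ⟨lt_of_le_of_ne hr.1 (Ne.symm h0), lt_of_le_of_ne hr.2 hT'⟩
    have hI := Icc_mem_nhds hr'.1 hr'.2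
    have hdx := ((hdx hr).differentiableAt hI).hasDerivAt
    have hevi := limit_evi hFc hM0 hD hη hη0 hX hu hr' (hXc r hr) hdx
    have := deriv_eq_proj hΩ (hcl r hr i) hevi (fun hfr =>
      tangent_zero hΩ hdx hfr (by
        filter_upwards [hI] with s hs
        exact hcl s hs i))
    have h5 := hdx.sub hd
    rw [this, sub_self] at h5
    exact h5)
  rw [uIcc_of_le hT] at hc
  have a1 := hc t ht
  have a2 := hc 0 ⟨le_rfl, hT⟩
  simp only [hG, intervalIntegral.integral_same, sub_zero, hinit] at a2
  rw [← a2] at a1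
  rw [← a1]
  simp [hG]

end mild
section final

variable {Ω : Set (Pt m)} {ν : Pt m → Pt m}

lemma stab_small {F : Fin n → ℝ → Conf m n → Pt m} {T M D L : ℝ} (hT : 0 ≤ T)
    (hM0 : 0 ≤ M) (hD : 0 ≤ D) (hL : 0 ≤ L)
    (hLip : ∀ i, ∀ t ∈ Icc (0:ℝ) T, ∀ X Y : Conf m n,
      ‖F i t X - F i t Y‖ ≤ L * ‖X - Y‖) (X0 : Conf m n) {r : ℝ} (hr : 0 < r) :
    ∃ δ > 0, ∀ η η' : ℝ, 0 ≤ η → 0 ≤ η' → η + η' < δ → ∀ X Y : ℝ → Conf m n,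
      IsApprox Ω F T M D X0 η X → IsApprox Ω F T M D X0 η' Y →
      ∀ t ∈ Icc (0:ℝ) T, ‖X t - Y t‖ < r := by
  have hc : Continuous (fun e : ℝ => gronwallBound 0 (n * (2 * L + 8 * D))
        (n * (8 * D * e ^ 2 + 4 * M * e)) T) :=
    (gronwallBound_continuous_ε 0 _ T).comp (by fun_prop)
  have h0 := hc.tendsto 0
  simp only [ne_eq, OfNat.ofNat_ne_zero, not_false_eq_true, zero_pow, mul_zero, add_zero,
    gronwallBound_ε0_δ0] at h0
  have hev := h0.eventually (gt_mem_nhds (show (0:ℝ) < r ^ 2 by positivity))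
  obtain ⟨δ, hδ, hb⟩ := Metric.eventually_nhds_iff_ball.1 hev
  refine ⟨δ, hδ, fun η η' hη hη' he X Y hX hY t ht => ?_⟩
  have h1 := approx_stability hT hM0 hD hL hLip hη hη' hX hY t ht
  have h2 := hb (η + η') (by
    rw [Metric.mem_ball, Real.dist_eq, sub_zero, abs_of_nonneg (by positivity)]; exact he)
  exact (sq_lt_sq₀ (norm_nonneg _) hr.le).1 (h1.trans_lt h2)

end final

/-- **Theorem (approximation theorem).**
Under the Lipschitz condition, for each `k > ‖F‖_∞/ε` the penalized problem has
a unique classical solution `X^k` on `[0,T]`, and `X^k` converges uniformly on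
`[0,T]`, as `k → ∞`, to the unique mild solution `X` of the confined system. -/
theorem penalized_approximation {m n : ℕ} (Ω : Set (Pt m)) (ν : Pt m → Pt m)
    (hΩ : IsC2Domain Ω ν) (ε : ℝ) (hε : 0 < ε)
    (hd1 : ContDiffOn ℝ 2 (distCl Ω) (closure (Metric.thickening ε (frontier Ω)) \ Ω))
    (hd2 : ∀ x ∈ closure (Metric.thickening ε Ω) \ closure Ω,
      ContDiffAt ℝ 2 (distCl Ω) x)
    (T : ℝ) (hT : 0 < T) (F : Fin n → ℝ → Conf m n → Pt m)
    (hFc : ∀ i, Continuous (Function.uncurry (F i)))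
    (M : ℝ) (hM : ∀ i, ∀ t ∈ Icc (0:ℝ) T, ∀ X : Conf m n, ‖F i t X‖ ≤ M)
    (L : ℝ) (hL : 0 < L)
    (hLip : ∀ i, ∀ t ∈ Icc (0:ℝ) T, ∀ X Y : Conf m n,
      ‖F i t X - F i t Y‖ ≤ L * ‖X - Y‖)
    (X0 : Conf m n) (hX0 : X0 ∈ Gset Ω n) :
    ∃ X : ℝ → Conf m n,
      IsMildSol Ω ν F T X0 X ∧
      (∀ Y, IsMildSol Ω ν F T X0 Y → ∀ t ∈ Icc (0:ℝ) T, Y t = X t) ∧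
      (∀ k : ℝ, M / ε < k → ∃ Xk : ℝ → Conf m n, IsPenalSol Ω F T k X0 Xk ∧
        ∀ Y, IsPenalSol Ω F T k X0 Y → ∀ t ∈ Icc (0:ℝ) T, Y t = Xk t) ∧
      (∀ Xfam : ℝ → ℝ → Conf m n,
        (∀ k, M / ε < k → IsPenalSol Ω F T k X0 (Xfam k)) →
        TendstoUniformlyOn (fun k t => Xfam k t) X atTop (Icc 0 T)) := by
  obtain ⟨C, hC0, hC⟩ := exists_prox_const hΩ
  rcases Nat.eq_zero_or_pos n with hn | hn
  · subst hn
    refine ⟨fun _ => X0, ⟨fun i => i.elim0, fun _ _ i => i.elim0, fun _ _ i => i.elim0⟩,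
      fun Y _ t _ => Subsingleton.elim _ _, fun k _ => ⟨fun _ => X0,
        ⟨rfl, fun i => i.elim0⟩, fun Y _ t _ => Subsingleton.elim _ _⟩, fun Xfam _ => ?_⟩
    rw [Metric.tendstoUniformlyOn_iff]
    intro r hr
    refine Eventually.of_forall fun k t _ => ?_
    rw [Subsingleton.elim (Xfam k t) X0, dist_self]
    exact hr
  have hM0 : 0 ≤ M := (norm_nonneg _).trans (hM ⟨0, hn⟩ 0 ⟨le_rfl, hT.le⟩ X0)
  have hD : 0 ≤ M * C := by positivity
  have hex := fun (k : ℝ) (hk : M / ε < k) =>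
    penal_exists hΩ hε hd2 hT hFc hM0 hM hL hLip hX0 hk
  have happ := fun (k : ℝ) (hk : M / ε < k) (Y : ℝ → Conf m n)
    (hY : IsPenalSol Ω F T k X0 Y) => penal_approx hΩ hε hd2 hC0 hC hM0 hM hX0 hk hY
  have hst := fun (r : ℝ) (hr : 0 < r) => stab_small (Ω := Ω) hT.le hM0 hD hL.le hLip X0 hr
  have hkj : ∀ j : ℕ, M / ε < M / ε + 1 + j := fun j => by
    have : (0:ℝ) ≤ j := Nat.cast_nonneg j
    linarith
  choose Xs hXs using fun j : ℕ => hex _ (hkj j)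
  set η : ℕ → ℝ := fun j => M / (M / ε + 1 + j) with hηdef
  have hη : ∀ j, 0 ≤ η j := fun j => by positivity
  have hη0 : Tendsto η atTop (𝓝 0) :=
    (tendsto_atTop_add_const_left _ _ tendsto_natCast_atTop_atTop).const_div_atTop M
  have hXa : ∀ j, IsApprox Ω F T M (M * C) X0 (η j) (Xs j) := fun j =>
    happ _ (hkj j) _ (hXs j)
  have hcau : UniformCauchySeqOn Xs atTop (Icc 0 T) := by
    rw [Metric.uniformCauchySeqOn_iff]
    intro r hr
    obtain ⟨δ, hδ, h⟩ := hst r hr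
    obtain ⟨N, hN⟩ := eventually_atTop.1
      (hη0.eventually (gt_mem_nhds (show (0:ℝ) < δ / 2 by positivity)))
    refine ⟨N, fun a ha b hb t ht => ?_⟩
    rw [dist_eq_norm]
    exact h _ _ (hη a) (hη b) (by linarith [hN a ha, hN b hb]) _ _ (hXa a) (hXa b) t ht
  have hlim : ∀ t, ∃ z, t ∈ Icc 0 T → Tendsto (fun j => Xs j t) atTop (𝓝 z) := by
    intro t
    by_cases ht : t ∈ Icc 0 T
    · obtain ⟨z, hz⟩ := cauchySeq_tendsto_of_complete (hcau.cauchySeq ht)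
      exact ⟨z, fun _ => hz⟩
    · exact ⟨X0, fun h => absurd h ht⟩
  choose X hXlim using hlim
  have hu : TendstoUniformlyOn Xs X atTop (Icc 0 T) :=
    hcau.tendstoUniformlyOn_of_tendsto fun t ht => hXlim t ht
  have hmild : IsMildSol Ω ν F T X0 X :=
    limit_mild hΩ hD hT.le hFc hM0 hM hη hη0 hXa hu
  have hma := fun (Y : ℝ → Conf m n) (hY : IsMildSol Ω ν F T X0 Y) =>
    mild_approx hΩ hC0 hC hT.le hFc hM0 hM hY
  refine ⟨X, hmild, fun Y hY t ht => ?_, fun k hk => ?_, fun Xfam hfam => ?_⟩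
  · have h : ∀ r : ℝ, 0 < r → ‖Y t - X t‖ ≤ r := fun r hr => by
      obtain ⟨δ, hδ, h⟩ := hst r hr
      exact (h 0 0 le_rfl le_rfl (by simpa using hδ) Y X (hma Y hY) (hma X hmild) t ht).le
    exact sub_eq_zero.1 (norm_le_zero_iff.1 (le_of_forall_pos_le_add fun r hr => by
      simpa using h r hr))
  · obtain ⟨Xk, hXk⟩ := hex k hk
    exact ⟨Xk, hXk, fun Y hY => penal_unique hΩ hε hd2 hM0 hM hL hLip hX0 hk hXk hY⟩
  · rw [Metric.tendstoUniformlyOn_iff]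
    intro r hr
    obtain ⟨δ, hδ, h⟩ := hst r hr
    have hk0 : Tendsto (fun k : ℝ => M / k) atTop (𝓝 0) := tendsto_id.const_div_atTop M
    filter_upwards [hk0.eventually (gt_mem_nhds hδ), eventually_gt_atTop (M / ε)] with k h1 hk t ht
    have hkp := (div_lt_eps hM0 hε hk).1
    rw [dist_eq_norm]
    exact h 0 (M / k) le_rfl (by positivity) (by simpa using h1) _ _ (hma X hmild)
      (happ k hk _ (hfam k hk)) t ht
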